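/- arXiv:0911.0278 — 2 statements merged into one kernel-verified Lean document; each statement's English description precedes it below -/
import Mathlib

section
/- With T(k) the number of isomorphism classes of admissible trees with k nodes and T̃(k) the number of isomorphism classes of pairs (Sk, e) with Sk a pseudo-tree with 2k+2 vertices and e in the outer (5k+4)-gonal orbit, one has T(k) = C(k)/(k+2) + T₂(k)/2 + 2T₃(k)/3 and T̃(k) = (5k+4)C(k)/(k+2), where T₂, T₃ are as follows: T₂(k)=C(k/2) for even k else 0, T₃(k)=C((k−1)/3) if k≡1 mod 3 else 0. -/
/-- A (finite) 3-regular ribbon graph together with connectedness: a 3-skeleton.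
`E` is the set of ends of edges, `op` is a free involution (sending an end to the
other end of the same edge) and `nx` is a free automorphism of order 3 (the next
end at the same vertex in the cyclic order). -/
structure ThreeSkeleton where
  E : Type
  fintypeE : Fintype E
  op : Equiv.Perm E
  nx : Equiv.Perm E
  op_free : ∀ e, op e ≠ e
  op_invol : ∀ e, op (op e) = e
  nx_free : ∀ e, nx e ≠ e
  nx_order : ∀ e, nx (nx (nx e)) = e
  connected : ∀ e e' : E,
    ∃ g ∈ Subgroup.closure ({op, nx} : Set (Equiv.Perm E)), g e = e'

/-- The permutation whose orbits are the faces (regions) of the ribbon graph. -/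
def ThreeSkeleton.z (Sk : ThreeSkeleton) : Equiv.Perm Sk.E :=
  Sk.op.trans Sk.nx.symm

/-- A pseudo-tree: a 3-skeleton obtained from an admissible plane tree by attaching
a loop at each leaf.  Combinatorially: all faces except exactly one are monogonal
(fixed points of `z`), and the Euler characteristic is that of the sphere, i.e.
with `|E| = 6n` there are `n + 1` monogonal faces, so `6·#fix(z) = |E| + 6`. -/
def IsPseudoTree (Sk : ThreeSkeleton) : Prop :=
  (∃ e₀ : Sk.E, Sk.z e₀ ≠ e₀ ∧ ∀ e : Sk.E, Sk.z e = e ∨ Sk.z.SameCycle e₀ e) ∧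
  6 * Nat.card {e : Sk.E // Sk.z e = e} = Nat.card Sk.E + 6

/-- The automorphism group of a ribbon graph: permutations of the set of edge ends
commuting with both `op` and `nx`. -/
def ribbonAut (Sk : ThreeSkeleton) : Subgroup (Equiv.Perm Sk.E) :=
  Subgroup.centralizer ({Sk.op, Sk.nx} : Set (Equiv.Perm Sk.E))

/-- A pseudo-tree with `2k+2` vertices (i.e. `6(k+1)` edge ends), corresponding to an
admissible tree with `k` nodes. -/
structure SizedPseudoTree (k : ℕ) where
  Sk : ThreeSkeleton
  isPT : IsPseudoTree Sk
  size : Nat.card Sk.E = 6 * (k + 1)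

/-- Isomorphism of (sized) pseudo-trees. -/
def SPTIso {k : ℕ} (A B : SizedPseudoTree k) : Prop :=
  ∃ f : A.Sk.E ≃ B.Sk.E,
    (∀ e, f (A.Sk.op e) = B.Sk.op (f e)) ∧
    (∀ e, f (A.Sk.nx e) = B.Sk.nx (f e))

/-- `T(k)`: the number of isomorphism classes of pseudo-trees with `2k+2` vertices
(equivalently, of admissible trees with `k` nodes). -/
noncomputable def Tcount (k : ℕ) : ℕ := Nat.card (Quot (@SPTIso k))

/-- `T_i(k)`: the number of isomorphism classes of pseudo-trees with `2k+2` vertices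
whose automorphism group has order `i`. -/
noncomputable def TNum (k i : ℕ) : ℕ :=
  Nat.card (Quot (fun A B : {S : SizedPseudoTree k // Nat.card (ribbonAut S.Sk) = i} =>
    SPTIso A.1 B.1))

/-- A pseudo-tree with `2k+2` vertices, pointed at an edge end in the outer
`(5k+4)`-gonal region (the unique non-monogonal face). -/
structure OuterPointedPseudoTree (k : ℕ) where
  Sk : ThreeSkeleton
  isPT : IsPseudoTree Sk
  size : Nat.card Sk.E = 6 * (k + 1)
  pt : Sk.E
  outer : Sk.z pt ≠ pt

/-- Isomorphism of outer-pointed pseudo-trees. -/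
def OPTIso {k : ℕ} (A B : OuterPointedPseudoTree k) : Prop :=
  ∃ f : A.Sk.E ≃ B.Sk.E,
    (∀ e, f (A.Sk.op e) = B.Sk.op (f e)) ∧
    (∀ e, f (A.Sk.nx e) = B.Sk.nx (f e)) ∧
    f A.pt = B.pt

/-- `T̃(k)`: the number of isomorphism classes of pseudo-trees with `2k+2` vertices
pointed at an element of the outer `(5k+4)`-gonal orbit. -/
noncomputable def TtildeNum (k : ℕ) : ℕ := Nat.card (Quot (@OPTIso k))

open BinaryTree

instance (S : ThreeSkeleton) : Fintype S.E := S.fintypeE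

namespace ThreeSkeleton

/-- `e` and `S.nx e` are the two ends of a loop, so that `e` bounds a monogon. -/
def IsMonogon (S : ThreeSkeleton) (e : S.E) : Prop := S.op e = S.nx e

/-- Traversing the edge at `e` from `e` to `S.op e`, the part of `S` that lies ahead unfolds to
the plane binary tree `t`; the leaves of `t` correspond to vertices carrying a loop. -/
def Branch (S : ThreeSkeleton) : BinaryTree Unit → S.E → Prop
  | nil, e => S.IsMonogon (S.nx (S.op e))
  | node _ l r, e => S.Branch l (S.nx (S.op e)) ∧ S.Branch r (S.nx (S.nx (S.op e)))

/-- A map of edge ends commuting with `op` and `nx`. -/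
def IsHom (S S' : ThreeSkeleton) (f : S.E → S'.E) : Prop :=
  (∀ e, f (S.op e) = S'.op (f e)) ∧ ∀ e, f (S.nx e) = S'.nx (f e)

variable {S S' : ThreeSkeleton}

theorem nx_inj {a b : S.E} : S.nx a = S.nx b ↔ a = b := S.nx.injective.eq_iff

theorem op_inj {a b : S.E} : S.op a = S.op b ↔ a = b := S.op.injective.eq_iff

theorem nx_nx_ne (e : S.E) : S.nx (S.nx e) ≠ e := fun h =>
  S.nx_free e (by simpa [h] using S.nx_order e)

theorem z_eq_iff {e : S.E} : S.z e = e ↔ S.IsMonogon e := by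
  simp [z, IsMonogon, Equiv.symm_apply_eq]

theorem z_eq (e : S.E) : S.z e = S.nx (S.nx (S.op e)) := by
  simp [z, Equiv.symm_apply_eq, S.nx_order]

theorem IsMonogon.not_nx {e : S.E} (h : S.IsMonogon e) : ¬ S.IsMonogon (S.nx e) := by
  intro h'
  unfold IsMonogon at h h'
  rw [← h, S.op_invol] at h'
  rw [h] at h'
  exact nx_nx_ne e h'.symm

theorem IsMonogon.not_nx_nx {e : S.E} (h : S.IsMonogon e) : ¬ S.IsMonogon (S.nx (S.nx e)) := by
  intro h'
  have := h'.not_nx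
  rw [S.nx_order] at this
  exact this h

theorem IsMonogon.op_eq {e : S.E} (h : S.IsMonogon (S.nx (S.nx e))) :
    S.op e = S.nx (S.nx e) := by
  rw [IsMonogon, S.nx_order] at h
  rw [← S.op_invol (S.nx (S.nx e)), h]

theorem conn_induction {p : S.E → Prop} (e₀ : S.E) (h₀ : p e₀) (hop : ∀ e, p e → p (S.op e))
    (hnx : ∀ e, p e → p (S.nx e)) (e : S.E) : p e := by
  obtain ⟨g, hg, rfl⟩ := S.connected e₀ e
  suffices ∀ x, p x ↔ p (g x) from (this e₀).1 h₀
  induction hg using Subgroup.closure_induction with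
  | mem x hx =>
    intro e
    rcases hx with rfl | rfl
    · exact ⟨hop e, fun h => by simpa [S.op_invol] using hop _ h⟩
    · exact ⟨hnx e, fun h => by simpa [S.nx_order] using hnx _ (hnx _ h)⟩
  | one => simp
  | mul x y _ _ hx hy => exact fun e => (hy e).trans (hx (y e))
  | inv x _ hx => exact fun e => by simpa using (hx (x⁻¹ e)).symm

theorem not_branch {t : BinaryTree Unit} {e : S.E}
    (h : S.IsMonogon e ∨ S.IsMonogon (S.nx (S.nx e))) : ¬ S.Branch t e := by
  induction t generalizing e with
  | nil =>
    rcases h with h | h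
    · have h1 := h.not_nx_nx
      rw [Branch, h]
      exact h1
    · have h1 := h.not_nx
      rwa [Branch, h.op_eq]
  | node v l r hl hr =>
    rintro ⟨h1, h2⟩
    rcases h with h | h
    · refine hr (Or.inl h) ?_
      rwa [h, S.nx_order] at h2
    · refine hl (Or.inr h) ?_
      rwa [h.op_eq, S.nx_order] at h1

theorem Branch.unique {t t' : BinaryTree Unit} {e : S.E} (h : S.Branch t e) (h' : S.Branch t' e) :
    t = t' := by
  induction t generalizing e t' with
  | nil =>
    cases t' with
    | nil => rfl
    | node v l r => exact absurd h'.1 (not_branch (Or.inl h))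
  | node v l r hl hr =>
    cases t' with
    | nil => exact absurd h.1 (not_branch (Or.inl h'))
    | node v l r => rw [hl h.1 h'.1, hr h.2 h'.2]

theorem branch_nil_op {e : S.E} : S.Branch nil (S.op e) ↔ S.IsMonogon (S.nx e) := by
  simp [Branch, S.op_invol]

theorem branch_node_op {u : Unit} {l r : BinaryTree Unit} {e : S.E} :
    S.Branch (node u l r) (S.op e) ↔ S.Branch l (S.nx e) ∧ S.Branch r (S.nx (S.nx e)) := by
  simp [Branch, S.op_invol]

theorem IsHom.monogon {f : S.E → S'.E} (hf : IsHom S S' f) {e : S.E} (h : S.IsMonogon e) :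
    S'.IsMonogon (f e) := by
  rw [IsMonogon, ← hf.1, h, hf.2]

theorem IsHom.branch {f : S.E → S'.E} (hf : IsHom S S' f) {t : BinaryTree Unit} {e : S.E}
    (h : S.Branch t e) : S'.Branch t (f e) := by
  induction t generalizing e with
  | nil =>
    have := hf.monogon h
    rwa [hf.2, hf.1] at this
  | node v l r hl hr =>
    have h1 := hl h.1
    have h2 := hr h.2
    simp only [hf.1, hf.2] at h1 h2
    exact ⟨h1, h2⟩

theorem IsHom.symm {f : S.E ≃ S'.E} (hf : IsHom S S' f) : IsHom S' S f.symm := by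
  constructor <;> intro e <;> rw [Equiv.symm_apply_eq]
  · simp [hf.1]
  · simp [hf.2]

theorem IsHom.comp {S'' : ThreeSkeleton} {f : S.E → S'.E} {g : S'.E → S''.E}
    (hg : IsHom S' S'' g) (hf : IsHom S S' f) : IsHom S S'' (g ∘ f) :=
  ⟨fun e => by simp [hf.1, hg.1], fun e => by simp [hf.2, hg.2]⟩

theorem IsHom.eq_of_apply_eq {f g : S.E → S'.E} (hf : IsHom S S' f) (hg : IsHom S S' g) {e₀ : S.E}
    (h : f e₀ = g e₀) : f = g := by
  funext e
  exact conn_induction (p := fun e => f e = g e) e₀ h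
    (fun e he => by rw [hf.1, hg.1, he]) (fun e he => by rw [hf.2, hg.2, he]) e

theorem IsHom.surjective {f : S.E → S'.E} (hf : IsHom S S' f) (e₀ : S.E) :
    Function.Surjective f := by
  refine conn_induction (p := fun e => ∃ x, f x = e) (f e₀) ⟨e₀, rfl⟩ ?_ ?_
  · rintro _ ⟨x, rfl⟩
    exact ⟨S.op x, hf.1 x⟩
  · rintro _ ⟨x, rfl⟩
    exact ⟨S.nx x, hf.2 x⟩

/-- Every end of an edge that is not a loop has a finite tree ahead of it. -/
def IsTreelike (S : ThreeSkeleton) : Prop :=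
  ∀ e, ¬ S.IsMonogon e → ¬ S.IsMonogon (S.nx (S.nx e)) → ∃ t, S.Branch t e

theorem isTreelike_of_branch {t : BinaryTree Unit} {s : S.E} (hs : S.IsMonogon (S.nx s))
    (ht : S.Branch t s) : S.IsTreelike := by
  let q : S.E → Prop := fun e => ¬ S.IsMonogon e → ¬ S.IsMonogon (S.nx (S.nx e)) → ∃ t, S.Branch t e
  suffices ∀ e, q e ∧ q (S.nx e) ∧ q (S.nx (S.nx e)) from fun e => (this e).1
  refine conn_induction s ⟨fun _ _ => ⟨t, ht⟩, fun h => absurd hs h, fun _ h => ?_⟩ ?_ ?_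
  · rw [S.nx_order] at h
    exact absurd hs h
  · rintro e ⟨h1, h2, h3⟩
    by_cases ha : S.IsMonogon e
    · rw [ha, S.nx_order]
      exact ⟨h2, h3, h1⟩
    by_cases hb : S.IsMonogon (S.nx (S.nx e))
    · have : S.op e = S.nx (S.nx e) := by
        rw [IsMonogon, S.nx_order] at hb
        rw [← hb, S.op_invol, hb]
      rw [this, S.nx_order]
      exact ⟨h3, h1, h2⟩
    refine ⟨fun _ _ => ?_, ?_⟩
    · by_cases hc : S.IsMonogon (S.nx e)
      · exact ⟨nil, branch_nil_op.2 hc⟩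
      · obtain ⟨l, hl⟩ := h2 hc (by rwa [S.nx_order])
        obtain ⟨r, hr⟩ := h3 hb (by rwa [S.nx_order])
        exact ⟨node () l r, branch_node_op.2 ⟨hl, hr⟩⟩
    · obtain ⟨t, ht⟩ := h1 ha hb
      cases t with
      | nil =>
        refine ⟨fun h => absurd ht h, fun _ h => ?_⟩
        rw [S.nx_order] at h
        exact absurd ht h
      | node v l r => exact ⟨fun _ _ => ⟨l, ht.1⟩, fun _ _ => ⟨r, ht.2⟩⟩
  · rintro e ⟨h1, h2, h3⟩
    rw [S.nx_order]
    exact ⟨h2, h3, h1⟩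

theorem sum_op (S : ThreeSkeleton) (f : S.E → ℤ) : ∑ e, f (S.op e) = ∑ e, f e :=
  Equiv.sum_comp S.op f

theorem sum_nx (S : ThreeSkeleton) (f : S.E → ℤ) : ∑ e, f (S.nx e) = ∑ e, f e :=
  Equiv.sum_comp S.nx f

theorem sum_nx_nx (S : ThreeSkeleton) (f : S.E → ℤ) : ∑ e, f (S.nx (S.nx e)) = ∑ e, f e :=
  (S.sum_nx fun e => f (S.nx e)).trans (S.sum_nx f)

open Classical in
/-- The Euler characteristic condition of a pseudo-tree. -/
def EulerTwo (S : ThreeSkeleton) : Prop :=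
  6 * ∑ e : S.E, (if S.IsMonogon e then (1 : ℤ) else 0) = Nat.card S.E + 6

theorem eulerTwo_iff :
    S.EulerTwo ↔ 6 * Nat.card {e : S.E // S.z e = e} = Nat.card S.E + 6 := by
  classical
  simp only [z_eq_iff, EulerTwo, Finset.sum_boole, Nat.card_eq_fintype_card, Fintype.card_subtype]
  norm_cast

theorem EulerTwo.exists_stalk (hS : S.EulerTwo) :
    ∃ s t, S.IsMonogon (S.nx s) ∧ S.Branch t s := by
  classical
  by_contra! hno
  let a : S.E → ℤ := fun e => if S.IsMonogon e then 1 else 0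
  let g : S.E → ℤ := fun e => if ∃ t, S.Branch t e then 1 else 0
  have key : ∀ e, (g e - g (S.op e)) + (g (S.nx e) - g (S.op (S.nx e))) +
      (g (S.nx (S.nx e)) - g (S.op (S.nx (S.nx e)))) ≤
      1 - 2 * (a e + a (S.nx e) + a (S.nx (S.nx e))) := by
    have leaf : ∀ e, S.IsMonogon e → g e = 0 ∧ g (S.op e) = 0 ∧ g (S.nx e) = 0 ∧
        g (S.op (S.nx e)) = 0 ∧ g (S.nx (S.nx e)) = 0 ∧ g (S.op (S.nx (S.nx e))) = 1 ∧
        a e = 1 ∧ a (S.nx e) = 0 ∧ a (S.nx (S.nx e)) = 0 := by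
      intro e he
      have h1 : g e = 0 := if_neg fun ⟨t, ht⟩ => not_branch (Or.inl he) ht
      have h2 : g (S.nx e) = 0 := if_neg fun ⟨t, ht⟩ => not_branch (Or.inr (by rwa [S.nx_order])) ht
      have h3 : g (S.nx (S.nx e)) = 0 := if_neg fun ⟨t, ht⟩ =>
        hno (S.nx (S.nx e)) t (by rwa [S.nx_order]) ht
      refine ⟨h1, by rwa [he], h2, ?_, h3, if_pos ⟨nil, branch_nil_op.2 (by rwa [S.nx_order])⟩,
        if_pos he, if_neg he.not_nx, if_neg he.not_nx_nx⟩
      rwa [← he, S.op_invol]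
    intro e
    by_cases ha : S.IsMonogon e
    · obtain ⟨h1, h2, h3, h4, h5, h6, h7, h8, h9⟩ := leaf e ha
      linarith
    by_cases hb : S.IsMonogon (S.nx e)
    · obtain ⟨h1, h2, h3, h4, h5, h6, h7, h8, h9⟩ := leaf _ hb
      simp only [S.nx_order] at h5 h6 h9
      linarith
    by_cases hc : S.IsMonogon (S.nx (S.nx e))
    · obtain ⟨h1, h2, h3, h4, h5, h6, h7, h8, h9⟩ := leaf _ hc
      simp only [S.nx_order] at h3 h4 h5 h6 h8 h9
      linarith
    have hg : ∀ e, ¬ S.IsMonogon (S.nx e) → g (S.nx e) * g (S.nx (S.nx e)) ≤ g (S.op e) := by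
      intro e he
      by_cases h1 : ∃ t, S.Branch t (S.nx e)
      · by_cases h2 : ∃ t, S.Branch t (S.nx (S.nx e))
        · obtain ⟨l, hl⟩ := h1
          obtain ⟨r, hr⟩ := h2
          have : g (S.op e) = 1 := if_pos ⟨node () l r, branch_node_op.2 ⟨hl, hr⟩⟩
          rw [this]
          simp only [g]
          split_ifs <;> simp
        · simp only [g, if_neg h2]
          split_ifs <;> simp
      · simp only [g, if_neg h1]
        split_ifs <;> simp
    have h1 := hg e hb
    have h2 := hg (S.nx e) hc
    have h3 := hg (S.nx (S.nx e)) (by rwa [S.nx_order])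
    rw [S.nx_order] at h2 h3
    have e1 : a e = 0 := if_neg ha
    have e2 : a (S.nx e) = 0 := if_neg hb
    have e3 : a (S.nx (S.nx e)) = 0 := if_neg hc
    have v : ∀ e, g e = 0 ∨ g e = 1 := fun e => by simp only [g]; split_ifs <;> simp
    rw [e1, e2, e3]
    rcases v e with w1 | w1 <;> rcases v (S.nx e) with w2 | w2 <;>
      rcases v (S.nx (S.nx e)) with w3 | w3 <;> rw [w1, w2, w3] <;>
      rw [w1, w2] at h3 <;> rw [w3, w1] at h2 <;> rw [w2, w3] at h1 <;> linarith
  have := Finset.sum_le_sum fun e (_ : e ∈ Finset.univ) => key e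
  simp only [Finset.sum_add_distrib, Finset.sum_sub_distrib, ← Finset.mul_sum] at this
  rw [S.sum_nx g, S.sum_nx_nx g, S.sum_nx a, S.sum_nx_nx a, S.sum_op g,
    S.sum_nx fun e => g (S.op e), S.sum_nx_nx fun e => g (S.op e), S.sum_op g] at this
  unfold EulerTwo at hS
  rw [Nat.card_eq_fintype_card] at hS
  simp only [Finset.sum_const, Finset.card_univ, nsmul_eq_mul, mul_one] at this
  linarith

theorem EulerTwo.isTreelike (hS : S.EulerTwo) : S.IsTreelike := by
  obtain ⟨s, t, hs, ht⟩ := hS.exists_stalk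
  exact isTreelike_of_branch hs ht

theorem IsHom.bijective {f : S.E → S'.E} (hf : IsHom S S' f) (hS : S.EulerTwo) (hS' : S'.EulerTwo) :
    Function.Bijective f := by
  classical
  obtain ⟨e₀, -⟩ := hS.exists_stalk
  let N : S'.E → ℤ := fun y => ∑ x, if f x = y then 1 else 0
  have hN : ∀ y, N y = N (f e₀) := by
    refine conn_induction (f e₀) rfl (fun y hy => ?_) fun y hy => ?_
    · refine (S.sum_op fun x => if f x = S'.op y then 1 else 0).symm.trans ?_
      simpa only [hf.1, op_inj] using hy
    · refine (S.sum_nx fun x => if f x = S'.nx y then 1 else 0).symm.trans ?_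
      simpa only [hf.2, nx_inj] using hy
  have hsum : ∀ w : S'.E → ℤ, ∑ x, w (f x) = N (f e₀) * ∑ y, w y := by
    intro w
    calc ∑ x, w (f x) = ∑ x, ∑ y, if f x = y then w y else 0 := by simp
      _ = ∑ y, ∑ x, if f x = y then w y else 0 := Finset.sum_comm
      _ = ∑ y, N y * w y := by simp only [N, Finset.sum_mul, ite_mul, one_mul, zero_mul]
      _ = N (f e₀) * ∑ y, w y := by simp only [hN, Finset.mul_sum]
  have hmono : ∀ x, S'.IsMonogon (f x) ↔ S.IsMonogon x := by
    refine fun x => ⟨fun h => ?_, hf.monogon⟩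
    by_contra hx
    by_cases hx' : S.IsMonogon (S.nx (S.nx x))
    · have := hf.monogon hx'
      rw [hf.2, hf.2] at this
      exact h.not_nx_nx this
    · obtain ⟨t, ht⟩ := hS.isTreelike x hx hx'
      exact not_branch (Or.inl h) (hf.branch ht)
  have h1 := hsum fun _ => 1
  have h2 := hsum fun y => if S'.IsMonogon y then 1 else 0
  simp only [hmono] at h2
  simp only [Finset.sum_const, Finset.card_univ, nsmul_eq_mul, mul_one] at h1
  unfold EulerTwo at hS hS'
  rw [Nat.card_eq_fintype_card] at hS hS'
  have hd : N (f e₀) = 1 := by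
    rw [h2, h1] at hS
    have : 6 * N (f e₀) = 6 := by linear_combination hS - N (f e₀) * hS'
    linarith
  rw [hd, one_mul] at h1
  exact (Fintype.bijective_iff_surjective_and_card f).2 ⟨hf.surjective e₀, by exact_mod_cast h1⟩

end ThreeSkeleton

namespace BinaryTree

/-- The edge ends of the ribbon graph obtained from the planar binary tree `t` with a dangling
root edge, by attaching loops at the leaves. -/
def Half : BinaryTree Unit → Type
  | nil => Fin 3
  | node _ l r => Fin 3 ⊕ (Half l ⊕ Half r)

/-- The edge end on the dangling root edge. -/
def halfRoot : (t : BinaryTree Unit) → Half t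
  | nil => (0 : Fin 3)
  | node _ _ _ => Sum.inl 0

/-- Rotation around the vertices. -/
def halfNx : (t : BinaryTree Unit) → Half t → Half t
  | nil => fun i : Fin 3 => (i + 1 : Fin 3)
  | node _ l r => Sum.map (· + 1) (Sum.map (halfNx l) (halfNx r))

/-- The other end of the edge at a given end, `none` for the dangling edge. -/
def halfOp : (t : BinaryTree Unit) → Half t → Option (Half t)
  | nil => ![none, some (2 : Fin 3), some (1 : Fin 3)]
  | node _ l r =>
    Sum.elim ![none, some (Sum.inr (Sum.inl l.halfRoot)), some (Sum.inr (Sum.inr r.halfRoot))]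
      (Sum.elim
        (fun d => some ((halfOp l d).elim (Sum.inl 1) fun d' => Sum.inr (Sum.inl d')))
        (fun d => some ((halfOp r d).elim (Sum.inl 2) fun d' => Sum.inr (Sum.inr d'))))

/-- The half-edges of `t` form a finite type. -/
@[reducible] def halfFintype : (t : BinaryTree Unit) → Fintype (Half t)
  | nil => inferInstanceAs (Fintype (Fin 3))
  | node _ l r =>
    letI := halfFintype l
    letI := halfFintype r
    inferInstanceAs (Fintype (Fin 3 ⊕ (Half l ⊕ Half r)))

instance (t : BinaryTree Unit) : Fintype (Half t) := halfFintype t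

theorem halfNx_halfNx_halfNx (t : BinaryTree Unit) (d : Half t) :
    t.halfNx (t.halfNx (t.halfNx d)) = d := by
  induction t with
  | nil =>
    change Fin 3 at d
    change d + 1 + 1 + 1 = d
    revert d
    decide
  | node v l r hl hr =>
    rcases d with i | d | d
    · refine congrArg Sum.inl (?_ : i + 1 + 1 + 1 = i)
      revert i
      decide
    · exact congrArg (Sum.inr ∘ Sum.inl) (hl d)
    · exact congrArg (Sum.inr ∘ Sum.inr) (hr d)

theorem halfNx_ne (t : BinaryTree Unit) (d : Half t) : t.halfNx d ≠ d := by
  induction t with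
  | nil =>
    change Fin 3 at d
    change d + 1 ≠ d
    revert d
    decide
  | node v l r hl hr =>
    rcases d with i | d | d <;> intro h
    · have hi : ∀ i : Fin 3, i + 1 ≠ i := by decide
      exact hi i (Sum.inl_injective h)
    · exact hl d (Sum.inl_injective (Sum.inr_injective h))
    · exact hr d (Sum.inr_injective (Sum.inr_injective h))

theorem halfOp_halfRoot (t : BinaryTree Unit) : t.halfOp t.halfRoot = none := by
  cases t <;> rfl

theorem eq_halfRoot_of_halfOp {t : BinaryTree Unit} {d : Half t} (h : t.halfOp d = none) :
    d = t.halfRoot := by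
  cases t with
  | nil =>
    change Fin 3 at d
    change ![none, some (2 : Fin 3), some (1 : Fin 3)] d = none at h
    change d = 0
    fin_cases d <;> simp_all
  | node v l r =>
    rcases d with i | d | d
    · fin_cases i
      · rfl
      · exact absurd h (Option.some_ne_none _)
      · exact absurd h (Option.some_ne_none _)
    · exact absurd h (Option.some_ne_none _)
    · exact absurd h (Option.some_ne_none _)

theorem halfOp_left {u : Unit} {l r : BinaryTree Unit} {d : Half l} {o : Option (Half l)}
    (h : l.halfOp d = o) : (node u l r).halfOp (Sum.inr (Sum.inl d)) =
      some (show Fin 3 ⊕ (Half l ⊕ Half r) from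
        o.elim (Sum.inl 1) fun d' => Sum.inr (Sum.inl d')) := by
  rw [← h]
  rfl

theorem halfOp_right {u : Unit} {l r : BinaryTree Unit} {d : Half r} {o : Option (Half r)}
    (h : r.halfOp d = o) : (node u l r).halfOp (Sum.inr (Sum.inr d)) =
      some (show Fin 3 ⊕ (Half l ⊕ Half r) from
        o.elim (Sum.inl 2) fun d' => Sum.inr (Sum.inr d')) := by
  rw [← h]
  rfl

theorem halfOp_symm {t : BinaryTree Unit} {d d' : Half t} (h : t.halfOp d = some d') :
    t.halfOp d' = some d ∧ d ≠ d' := by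
  induction t with
  | nil =>
    change Fin 3 at d d'
    change ![none, some (2 : Fin 3), some (1 : Fin 3)] d = some d' at h
    change ![none, some (2 : Fin 3), some (1 : Fin 3)] d' = some d ∧ d ≠ d'
    revert d d'
    decide
  | node v l r hl hr =>
    rcases d with i | d | d
    · fin_cases i
      · exact absurd h.symm (Option.some_ne_none _)
      · obtain rfl := Option.some_injective _ h
        exact ⟨halfOp_left l.halfOp_halfRoot, Sum.inl_ne_inr⟩
      · obtain rfl := Option.some_injective _ h
        exact ⟨halfOp_right r.halfOp_halfRoot, Sum.inl_ne_inr⟩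
    · rcases hd : l.halfOp d with _ | e
      · rw [halfOp_left hd] at h
        obtain rfl := Option.some_injective _ h
        exact ⟨by rw [eq_halfRoot_of_halfOp hd]; rfl, Sum.inr_ne_inl⟩
      · rw [halfOp_left hd] at h
        obtain rfl := Option.some_injective _ h
        obtain ⟨h1, h2⟩ := hl hd
        exact ⟨halfOp_left h1, fun h => h2 (Sum.inl_injective (Sum.inr_injective h))⟩
    · rcases hd : r.halfOp d with _ | e
      · rw [halfOp_right hd] at h
        obtain rfl := Option.some_injective _ h
        exact ⟨by rw [eq_halfRoot_of_halfOp hd]; rfl, Sum.inr_ne_inl⟩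
      · rw [halfOp_right hd] at h
        obtain rfl := Option.some_injective _ h
        obtain ⟨h1, h2⟩ := hr hd
        exact ⟨halfOp_right h1, fun h => h2 (Sum.inr_injective (Sum.inr_injective h))⟩

theorem card_half (t : BinaryTree Unit) : Fintype.card (Half t) = 6 * t.numNodes + 3 := by
  induction t with
  | nil => rfl
  | node v l r hl hr =>
    change Fintype.card (Fin 3 ⊕ (Half l ⊕ Half r)) = _
    rw [Fintype.card_sum, Fintype.card_sum, hl, hr, Fintype.card_fin, numNodes]
    ring

open Classical in
theorem sum_half_monogon (t : BinaryTree Unit) :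
    ∑ d, (if t.halfOp d = some (t.halfNx d) then (1 : ℤ) else 0) = t.numNodes + 1 := by
  induction t with
  | nil =>
    refine Eq.trans (b := ∑ d : Fin 3, (if ![none, some (2 : Fin 3), some (1 : Fin 3)] d =
      some (d + 1) then (1 : ℤ) else 0)) (Finset.sum_congr rfl fun d _ => if_congr Iff.rfl rfl rfl)
      ?_
    rw [Fin.sum_univ_three]
    simp
  | node v l r hl hr =>
    change ∑ d : Fin 3 ⊕ (Half l ⊕ Half r), _ = _
    rw [Fintype.sum_sum_type, Fintype.sum_sum_type, Fin.sum_univ_three]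
    have hleft : ∀ d : Half l, (node v l r).halfOp (Sum.inr (Sum.inl d)) =
        some ((node v l r).halfNx (Sum.inr (Sum.inl d))) ↔ l.halfOp d = some (l.halfNx d) := by
      intro d
      rcases hd : l.halfOp d with _ | e
      · rw [halfOp_left hd]
        refine iff_of_false (fun h => ?_) (Option.some_ne_none _).symm
        exact Sum.inl_ne_inr (Option.some_injective _ h)
      · rw [halfOp_left hd]
        refine ⟨fun h => congrArg some ?_, fun h => ?_⟩
        · exact Sum.inl_injective (Sum.inr_injective (Option.some_injective _ h))
        · exact congrArg (some ∘ Sum.inr ∘ Sum.inl) (Option.some_injective _ h)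
    have hright : ∀ d : Half r, (node v l r).halfOp (Sum.inr (Sum.inr d)) =
        some ((node v l r).halfNx (Sum.inr (Sum.inr d))) ↔ r.halfOp d = some (r.halfNx d) := by
      intro d
      rcases hd : r.halfOp d with _ | e
      · rw [halfOp_right hd]
        refine iff_of_false (fun h => ?_) (Option.some_ne_none _).symm
        exact Sum.inl_ne_inr (Option.some_injective _ h)
      · rw [halfOp_right hd]
        refine ⟨fun h => congrArg some ?_, fun h => ?_⟩
        · exact Sum.inr_injective (Sum.inr_injective (Option.some_injective _ h))
        · exact congrArg (some ∘ Sum.inr ∘ Sum.inr) (Option.some_injective _ h)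
    have hmid : ∀ i : Fin 3, (node v l r).halfOp (Sum.inl i) ≠
        some ((node v l r).halfNx (Sum.inl i)) := by
      intro i h
      fin_cases i
      · exact Option.some_ne_none _ h.symm
      · exact Sum.inr_ne_inl (Option.some_injective _ h)
      · exact Sum.inr_ne_inl (Option.some_injective _ h)
    simp only [hleft, hright, hl, hr, hmid, if_false, numNodes]
    push_cast
    ring

theorem half_induction {t : BinaryTree Unit} {p : Half t → Prop} (h₀ : p t.halfRoot)
    (hop : ∀ d d', t.halfOp d = some d' → p d → p d') (hnx : ∀ d, p d → p (t.halfNx d))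
    (d : Half t) : p d := by
  induction t with
  | nil =>
    change Fin 3 at d
    fin_cases d
    · exact h₀
    · exact hnx _ h₀
    · exact hnx _ (hnx _ h₀)
  | node v l r hl hr =>
    have h1 : p (Sum.inl 1) := hnx _ h₀
    have h2 : p (Sum.inl 2) := hnx _ h1
    rcases d with i | d | d
    · fin_cases i
      · exact h₀
      · exact h1
      · exact h2
    · refine hl (p := fun d => p (Sum.inr (Sum.inl d))) (hop (Sum.inl 1) _ rfl h1)
        (fun d d' h => hop _ _ (halfOp_left h)) (fun d => hnx _) d
    · refine hr (p := fun d => p (Sum.inr (Sum.inr d))) (hop (Sum.inl 2) _ rfl h2)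
        (fun d d' h => hop _ _ (halfOp_right h)) (fun d => hnx _) d

/-- The other end of an edge in the pseudo-tree of `t`. -/
def fullOp (t : BinaryTree Unit) : Fin 3 ⊕ Half t → Fin 3 ⊕ Half t :=
  Sum.elim ![Sum.inr t.halfRoot, Sum.inl 2, Sum.inl 1]
    fun d => (t.halfOp d).elim (Sum.inl 0) Sum.inr

/-- Rotation around the vertices in the pseudo-tree of `t`. -/
def fullNx (t : BinaryTree Unit) : Fin 3 ⊕ Half t → Fin 3 ⊕ Half t :=
  Sum.map (· + 1) t.halfNx

theorem fullOp_spec (t : BinaryTree Unit) (e : Fin 3 ⊕ Half t) :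
    t.fullOp (t.fullOp e) = e ∧ t.fullOp e ≠ e := by
  rcases e with i | d
  · fin_cases i <;> simp [fullOp, halfOp_halfRoot]
  · rcases hd : t.halfOp d with _ | d'
    · simp [fullOp, eq_halfRoot_of_halfOp hd, halfOp_halfRoot]
    · obtain ⟨h1, h2⟩ := halfOp_symm hd
      simp [fullOp, hd, h1, h2.symm]

theorem fullNx_fullNx_fullNx (t : BinaryTree Unit) (e : Fin 3 ⊕ Half t) :
    t.fullNx (t.fullNx (t.fullNx e)) = e := by
  rcases e with i | d
  · refine congrArg Sum.inl (?_ : i + 1 + 1 + 1 = i)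
    revert i
    decide
  · exact congrArg Sum.inr (t.halfNx_halfNx_halfNx d)

theorem full_induction {t : BinaryTree Unit} {p : Fin 3 ⊕ Half t → Prop} (h₀ : p (Sum.inl 0))
    (hop : ∀ e, p e → p (t.fullOp e)) (hnx : ∀ e, p e → p (t.fullNx e)) (e) : p e := by
  rcases e with i | d
  · fin_cases i
    · exact h₀
    · exact hnx _ h₀
    · exact hnx _ (hnx _ h₀)
  · refine half_induction (p := fun d => p (Sum.inr d)) (hop _ h₀) (fun d d' h hd => ?_)
      (fun d => hnx _) d
    have := hop _ hd
    simpa [fullOp, h] using this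

/-- The pseudo-tree of a planar binary tree, with an extra leaf at the root. -/
def skeleton (t : BinaryTree Unit) : ThreeSkeleton where
  E := Fin 3 ⊕ Half t
  fintypeE := inferInstance
  op := Function.Involutive.toPerm t.fullOp fun e => (t.fullOp_spec e).1
  nx := ⟨t.fullNx, fun e => t.fullNx (t.fullNx e), t.fullNx_fullNx_fullNx,
    t.fullNx_fullNx_fullNx⟩
  op_free e := (t.fullOp_spec e).2
  op_invol e := (t.fullOp_spec e).1
  nx_free e := by
    rcases e with i | d <;> intro h
    · have hi : ∀ i : Fin 3, i + 1 ≠ i := by decide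
      exact hi i (Sum.inl_injective h)
    · exact t.halfNx_ne d (Sum.inr_injective h)
  nx_order := t.fullNx_fullNx_fullNx
  connected := by
    set op : Equiv.Perm (Fin 3 ⊕ Half t) :=
      Function.Involutive.toPerm t.fullOp fun e => (t.fullOp_spec e).1
    set nx : Equiv.Perm (Fin 3 ⊕ Half t) := ⟨t.fullNx, fun e => t.fullNx (t.fullNx e),
      t.fullNx_fullNx_fullNx, t.fullNx_fullNx_fullNx⟩
    have key : ∀ e, ∃ g ∈ Subgroup.closure {op, nx}, g (Sum.inl 0) = e := by
      refine full_induction ⟨1, one_mem _, rfl⟩ ?_ ?_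
      · rintro _ ⟨g, hg, rfl⟩
        exact ⟨op * g, mul_mem (Subgroup.subset_closure (by simp)) hg, rfl⟩
      · rintro _ ⟨g, hg, rfl⟩
        exact ⟨nx * g, mul_mem (Subgroup.subset_closure (by simp)) hg, rfl⟩
    intro e e'
    obtain ⟨g, hg, rfl⟩ := key e
    obtain ⟨g', hg', rfl⟩ := key e'
    exact ⟨g' * g⁻¹, mul_mem hg' (inv_mem hg), by simp⟩

theorem card_skeleton (t : BinaryTree Unit) : Nat.card t.skeleton.E = 6 * (t.numNodes + 1) := by
  change Nat.card (Fin 3 ⊕ Half t) = _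
  rw [Nat.card_eq_fintype_card, Fintype.card_sum, card_half, Fintype.card_fin]
  ring

theorem eulerTwo_skeleton (t : BinaryTree Unit) : t.skeleton.EulerTwo := by
  classical
  rw [ThreeSkeleton.EulerTwo, card_skeleton]
  have h : ∑ e : t.skeleton.E, (if t.skeleton.IsMonogon e then (1 : ℤ) else 0) =
      t.numNodes + 2 := by
    have h1 : ∀ e, t.skeleton.IsMonogon e ↔ t.fullOp e = t.fullNx e := fun e => Iff.rfl
    simp only [h1]
    change ∑ e : Fin 3 ⊕ Half t, _ = _
    rw [Fintype.sum_sum_type, Fin.sum_univ_three]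
    have h2 : ∀ d : Half t, t.fullOp (Sum.inr d) = t.fullNx (Sum.inr d) ↔
        t.halfOp d = some (t.halfNx d) := by
      intro d
      rcases hd : t.halfOp d <;> simp [fullOp, fullNx, hd]
    simp only [h2, sum_half_monogon]
    simp [fullOp, fullNx]
    ring
  rw [h]
  push_cast
  ring

theorem branch_of_half {S : ThreeSkeleton} {t : BinaryTree Unit} {G : Half t → S.E}
    (hnx : ∀ d, G (t.halfNx d) = S.nx (G d))
    (hop : ∀ d d', t.halfOp d = some d' → S.op (G d) = G d') {e : S.E}
    (he : S.op e = G t.halfRoot) : S.Branch t e := by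
  induction t generalizing e with
  | nil =>
    rw [ThreeSkeleton.Branch, ThreeSkeleton.IsMonogon, he, ← hnx, ← hnx]
    exact hop (1 : Fin 3) (2 : Fin 3) rfl
  | node v l r hl hr =>
    rw [ThreeSkeleton.Branch, he, ← hnx, ← hnx]
    refine ⟨hl (G := fun d => G (Sum.inr (Sum.inl d))) (fun d => hnx (Sum.inr (Sum.inl d)))
        (fun d d' h => hop _ _ (halfOp_left h)) (hop _ _ rfl),
      hr (G := fun d => G (Sum.inr (Sum.inr d))) (fun d => hnx (Sum.inr (Sum.inr d)))
        (fun d d' h => hop _ _ (halfOp_right h)) (hop _ _ rfl)⟩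

theorem isMonogon_skeleton (t : BinaryTree Unit) :
    t.skeleton.IsMonogon (t.skeleton.nx (Sum.inl 0)) := rfl

theorem branch_skeleton (t : BinaryTree Unit) : t.skeleton.Branch t (Sum.inl 0) := by
  refine branch_of_half (S := t.skeleton) (G := Sum.inr) (fun _ => rfl) (fun d d' h => ?_) rfl
  change t.fullOp (Sum.inr d) = _
  simp [fullOp, h]

/-- The map from the half-edges of `t` to a ribbon graph sending the root to `x`. -/
def halfMap (S : ThreeSkeleton) : (t : BinaryTree Unit) → S.E → Half t → S.E
  | nil, x => ![x, S.nx x, S.nx (S.nx x)]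
  | node _ l r, x => Sum.elim ![x, S.nx x, S.nx (S.nx x)]
      (Sum.elim (halfMap S l (S.op (S.nx x))) (halfMap S r (S.op (S.nx (S.nx x)))))

theorem vec_nx {S : ThreeSkeleton} (x : S.E) (i : Fin 3) :
    ![x, S.nx x, S.nx (S.nx x)] (i + 1) = S.nx (![x, S.nx x, S.nx (S.nx x)] i) := by
  fin_cases i <;> simp [S.nx_order]

theorem halfMap_halfRoot (S : ThreeSkeleton) (t : BinaryTree Unit) (x : S.E) :
    halfMap S t x t.halfRoot = x := by
  cases t <;> rfl

theorem halfMap_halfNx (S : ThreeSkeleton) (t : BinaryTree Unit) (x : S.E) (d : Half t) :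
    halfMap S t x (t.halfNx d) = S.nx (halfMap S t x d) := by
  induction t generalizing x with
  | nil => exact vec_nx x d
  | node v l r hl hr =>
    rcases d with i | d | d
    · exact vec_nx x i
    · exact hl _ d
    · exact hr _ d

theorem op_halfMap {S : ThreeSkeleton} {t : BinaryTree Unit} {e : S.E} (h : S.Branch t e)
    (d : Half t) :
    S.op (halfMap S t (S.op e) d) = (t.halfOp d).elim e (halfMap S t (S.op e)) := by
  induction t generalizing e with
  | nil =>
    change Fin 3 at d
    have h : S.op (S.nx (S.op e)) = S.nx (S.nx (S.op e)) := h
    fin_cases d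
    · exact S.op_invol e
    · exact h
    · change S.op (S.nx (S.nx (S.op e))) = S.nx (S.op e)
      rw [← h, S.op_invol]
  | node v l r hl hr =>
    rcases d with i | d | d
    · fin_cases i
      · exact S.op_invol e
      · exact (halfMap_halfRoot S l _).symm
      · exact (halfMap_halfRoot S r _).symm
    · refine (hl h.1 d).trans ?_
      rcases hd : l.halfOp d with _ | e <;> rw [halfOp_left hd] <;> rfl
    · refine (hr h.2 d).trans ?_
      rcases hd : r.halfOp d with _ | e <;> rw [halfOp_right hd] <;> rfl

/-- The map from the pseudo-tree of `t` to a ribbon graph sending the root leaf to `s`. -/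
def fullMap (S : ThreeSkeleton) (t : BinaryTree Unit) (s : S.E) : t.skeleton.E → S.E :=
  Sum.elim ![s, S.nx s, S.nx (S.nx s)] (halfMap S t (S.op s))

theorem isHom_fullMap {S : ThreeSkeleton} {t : BinaryTree Unit} {s : S.E}
    (hs : S.IsMonogon (S.nx s)) (h : S.Branch t s) : t.skeleton.IsHom S (fullMap S t s) := by
  constructor
  · rintro (i | d)
    · have hs : S.op (S.nx s) = S.nx (S.nx s) := hs
      fin_cases i
      · exact halfMap_halfRoot S t _
      · exact hs.symm
      · change S.nx s = S.op (S.nx (S.nx s))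
        rw [← hs, S.op_invol]
    · refine Eq.trans ?_ (op_halfMap h d).symm
      change fullMap S t s (t.fullOp (Sum.inr d)) = _
      rcases hd : t.halfOp d <;> simp [fullOp, fullMap, hd]
  · rintro (i | d)
    · exact vec_nx s i
    · exact halfMap_halfNx S t _ d

end BinaryTree

namespace ThreeSkeleton

variable {S S' : ThreeSkeleton}

theorem Branch.sameCycle {t : BinaryTree Unit} {e : S.E} (h : S.Branch t e) :
    S.z.SameCycle e (S.op e) := by
  have key : ∀ x, S.z.SameCycle e x → S.z.SameCycle e (S.nx (S.nx (S.op x))) := fun x hx => by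
    rwa [← z_eq, Equiv.Perm.sameCycle_apply_right]
  have h0 := key e (Equiv.Perm.SameCycle.refl _ _)
  induction t generalizing e with
  | nil =>
    have h : S.op (S.nx (S.op e)) = S.nx (S.nx (S.op e)) := h
    have := key _ h0
    rwa [← h, S.op_invol, S.nx_order] at this
  | node v l r hl hr =>
    have refl := fun e => Equiv.Perm.SameCycle.refl S.z e
    have step : ∀ e x, S.z.SameCycle e x → S.z.SameCycle e (S.nx (S.nx (S.op x))) :=
      fun e x hx => by rwa [← z_eq, Equiv.Perm.sameCycle_apply_right]
    have h1 := key _ (h0.trans (hr h.2 (step _) (step _ _ (refl _))))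
    rw [S.op_invol, S.nx_order] at h1
    have h2 := key _ (h1.trans (hl h.1 (step _) (step _ _ (refl _))))
    rwa [S.op_invol, S.nx_order] at h2

theorem EulerTwo.isPseudoTree (hS : S.EulerTwo) : IsPseudoTree S := by
  obtain ⟨s, t, hs, ht⟩ := hS.exists_stalk
  refine ⟨⟨s, fun h => not_branch (Or.inl (z_eq_iff.1 h)) ht, ?_⟩, eulerTwo_iff.1 hS⟩
  let p : S.E → Prop := fun e => S.z e = e ∨ S.z.SameCycle s e
  suffices ∀ e, p e ∧ p (S.nx e) ∧ p (S.nx (S.nx e)) from fun e => (this e).1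
  have step : ∀ x, S.z.SameCycle s x → S.z.SameCycle s (S.nx (S.nx (S.op x))) := fun x hx => by
    rwa [← z_eq, Equiv.Perm.sameCycle_apply_right]
  refine conn_induction s ⟨Or.inr (.refl _ _), Or.inl (z_eq_iff.2 hs), Or.inr ?_⟩ ?_ ?_
  · have := step _ ht.sameCycle
    rwa [S.op_invol] at this
  · rintro e ⟨h1, h2, h3⟩
    by_cases ha : S.IsMonogon e
    · rw [ha, S.nx_order]
      exact ⟨h2, h3, h1⟩
    by_cases hb : S.IsMonogon (S.nx (S.nx e))
    · rw [hb.op_eq, S.nx_order]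
      exact ⟨h3, h1, h2⟩
    obtain ⟨t, ht⟩ := hS.isTreelike e ha hb
    have he : S.z.SameCycle s e := h1.resolve_left (mt z_eq_iff.1 ha)
    refine ⟨Or.inr (he.trans ht.sameCycle), ?_, Or.inr (step _ he)⟩
    cases t with
    | nil => exact Or.inl (z_eq_iff.2 ht)
    | node v l r =>
      have := step _ ((step _ he).trans ht.2.sameCycle)
      rw [S.op_invol, S.nx_order] at this
      exact Or.inr this
  · rintro e ⟨h1, h2, h3⟩
    rw [S.nx_order]
    exact ⟨h2, h3, h1⟩

theorem isPseudoTree_iff : IsPseudoTree S ↔ S.EulerTwo :=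
  ⟨fun h => eulerTwo_iff.2 h.2, EulerTwo.isPseudoTree⟩

theorem exists_equiv_skeleton {t : BinaryTree Unit} {s : S.E} (hS : S.EulerTwo)
    (hs : S.IsMonogon (S.nx s)) (h : S.Branch t s) :
    ∃ f : t.skeleton.E ≃ S.E, IsHom t.skeleton S f ∧ f (Sum.inl 0) = s :=
  ⟨Equiv.ofBijective _ ((isHom_fullMap hs h).bijective t.eulerTwo_skeleton hS),
    isHom_fullMap hs h, rfl⟩

theorem exists_of_pair (a b : BinaryTree Unit) : ∃ (S : ThreeSkeleton) (e : S.E), S.EulerTwo ∧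
    Nat.card S.E = 6 * (a.numNodes + b.numNodes + 1) ∧ S.Branch a e ∧ S.Branch b (S.op e) := by
  induction b generalizing a with
  | nil => exact ⟨a.skeleton, Sum.inl 0, a.eulerTwo_skeleton, a.card_skeleton, a.branch_skeleton,
      branch_nil_op.2 a.isMonogon_skeleton⟩
  | node v l r hl _ =>
    obtain ⟨S, e, hS, hc, h1, h2⟩ := hl (node () r a)
    refine ⟨S, S.nx (S.nx (S.op e)), hS, ?_, h1.2, ?_⟩
    · rw [hc]
      simp only [numNodes]
      ring
    · refine branch_node_op.2 ?_
      rw [S.nx_order]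
      exact ⟨h2, h1.1⟩

theorem numNodes_of_pair {a b : BinaryTree Unit} (hS : S.EulerTwo) {e : S.E} (ha : S.Branch a e)
    (hb : S.Branch b (S.op e)) : Nat.card S.E = 6 * (a.numNodes + b.numNodes + 1) := by
  induction b generalizing a e with
  | nil =>
    obtain ⟨f, -, -⟩ := exists_equiv_skeleton hS (branch_nil_op.1 hb) ha
    rw [← Nat.card_congr f, card_skeleton]
    rfl
  | node v l r hl _ =>
    rw [branch_node_op] at hb
    rw [hl (a := node () r a) (e := S.op (S.nx e)) (branch_node_op.2 ⟨hb.2, ?_⟩) ?_]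
    · simp only [numNodes]
      ring
    · rwa [S.nx_order]
    · rw [S.op_invol]
      exact hb.1

theorem exists_equiv_of_pair {a b : BinaryTree Unit} (hS : S.EulerTwo) (hS' : S'.EulerTwo)
    {e : S.E} (ha : S.Branch a e) (hb : S.Branch b (S.op e)) {e' : S'.E} (ha' : S'.Branch a e')
    (hb' : S'.Branch b (S'.op e')) : ∃ f : S.E ≃ S'.E, IsHom S S' f ∧ f e = e' := by
  induction b generalizing a e e' with
  | nil =>
    obtain ⟨f, hf, rfl⟩ := exists_equiv_skeleton hS (branch_nil_op.1 hb) ha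
    obtain ⟨f', hf', rfl⟩ := exists_equiv_skeleton hS' (branch_nil_op.1 hb') ha'
    exact ⟨f.symm.trans f', hf'.comp hf.symm, congrArg f' (f.symm_apply_apply _)⟩
  | node v l r hl _ =>
    rw [branch_node_op] at hb hb'
    obtain ⟨f, hf, h⟩ := hl (a := node () r a) (e := S.op (S.nx e)) (e' := S'.op (S'.nx e'))
      (branch_node_op.2 ⟨hb.2, by rwa [S.nx_order]⟩) (by rw [S.op_invol]; exact hb.1)
      (branch_node_op.2 ⟨hb'.2, by rwa [S'.nx_order]⟩) (by rw [S'.op_invol]; exact hb'.1)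
    refine ⟨f, hf, ?_⟩
    rwa [hf.1, hf.2, op_inj, nx_inj] at h

theorem EulerTwo.exists_pair (hS : S.EulerTwo) {e : S.E} (h₁ : ¬ S.IsMonogon e)
    (h₂ : ¬ S.IsMonogon (S.nx (S.nx e))) : ∃ a b, S.Branch a e ∧ S.Branch b (S.op e) := by
  obtain ⟨a, ha⟩ := hS.isTreelike e h₁ h₂
  by_cases h : S.IsMonogon (S.nx e)
  · exact ⟨a, nil, ha, branch_nil_op.2 h⟩
  · obtain ⟨l, hl⟩ := hS.isTreelike (S.nx e) h (by rwa [S.nx_order])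
    obtain ⟨r, hr⟩ := hS.isTreelike (S.nx (S.nx e)) h₂ (by rwa [S.nx_order])
    exact ⟨a, node () l r, ha, branch_node_op.2 ⟨hl, hr⟩⟩

/-- The edge at `e` bisects the tree with `k` nodes underlying `S`. -/
def IsBicentroid (S : ThreeSkeleton) (k : ℕ) (e : S.E) : Prop :=
  ∃ t, S.Branch t e ∧ 2 * t.numNodes = k

/-- The vertex at `e` is a centroid of the tree with `k` nodes underlying `S`. -/
def IsCentroid (S : ThreeSkeleton) (k : ℕ) (e : S.E) : Prop :=
  ∃ t₀ t₁ t₂, (S.Branch t₀ e ∧ S.Branch t₁ (S.nx e) ∧ S.Branch t₂ (S.nx (S.nx e))) ∧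
    2 * t₀.numNodes < k ∧ 2 * t₁.numNodes < k ∧ 2 * t₂.numNodes < k

/-- At least half of the `k` nodes lie ahead of `e`. -/
def IsHeavy (S : ThreeSkeleton) (k : ℕ) (e : S.E) : Prop :=
  ∃ t, S.Branch t e ∧ k ≤ 2 * t.numNodes

theorem Branch.isBicentroid_iff {t : BinaryTree Unit} {e : S.E} (h : S.Branch t e) {k : ℕ} :
    S.IsBicentroid k e ↔ 2 * t.numNodes = k :=
  ⟨fun ⟨_, h', hk⟩ => h.unique h' ▸ hk, fun hk => ⟨t, h, hk⟩⟩

theorem Branch.isHeavy_iff {t : BinaryTree Unit} {e : S.E} (h : S.Branch t e) {k : ℕ} :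
    S.IsHeavy k e ↔ k ≤ 2 * t.numNodes :=
  ⟨fun ⟨_, h', hk⟩ => h.unique h' ▸ hk, fun hk => ⟨t, h, hk⟩⟩

theorem Branch.isCentroid_iff {t₀ t₁ t₂ : BinaryTree Unit} {e : S.E} (h₀ : S.Branch t₀ e)
    (h₁ : S.Branch t₁ (S.nx e)) (h₂ : S.Branch t₂ (S.nx (S.nx e))) {k : ℕ} :
    S.IsCentroid k e ↔ 2 * t₀.numNodes < k ∧ 2 * t₁.numNodes < k ∧ 2 * t₂.numNodes < k :=
  ⟨fun ⟨_, _, _, ⟨h₀', h₁', h₂'⟩, hk⟩ => h₀.unique h₀' ▸ h₁.unique h₁' ▸ h₂.unique h₂' ▸ hk,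
    fun hk => ⟨t₀, t₁, t₂, ⟨h₀, h₁, h₂⟩, hk⟩⟩

theorem IsCentroid.nx {k : ℕ} {e : S.E} : S.IsCentroid k e → S.IsCentroid k (S.nx e) := by
  rintro ⟨t₀, t₁, t₂, ⟨h₀, h₁, h₂⟩, k₀, k₁, k₂⟩
  exact ⟨t₁, t₂, t₀, ⟨h₁, h₂, by rwa [S.nx_order]⟩, k₁, k₂, k₀⟩

theorem isCentroid_nx {k : ℕ} {e : S.E} : S.IsCentroid k (S.nx e) ↔ S.IsCentroid k e :=
  ⟨fun h => by simpa [S.nx_order] using h.nx.nx, IsCentroid.nx⟩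

open Classical in
theorem heavy_add_heavy_op (hS : S.EulerTwo) {k : ℕ} (hk : Nat.card S.E = 6 * (k + 1)) (e : S.E) :
    ((if S.IsHeavy k e then 1 else 0) + (if S.IsHeavy k (S.op e) then 1 else 0) : ℤ) =
      1 - (if S.IsMonogon e then 1 else 0) - (if S.IsMonogon (S.nx (S.nx e)) then 1 else 0) +
        (if S.IsBicentroid k e then 1 else 0) := by
  by_cases h₁ : S.IsMonogon e
  · have n₁ : ¬ S.IsHeavy k e := fun ⟨t, ht, _⟩ => not_branch (Or.inl h₁) ht
    have n₂ : ¬ S.IsHeavy k (S.op e) := fun ⟨t, ht, _⟩ =>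
      not_branch (Or.inr (by rwa [h₁, S.nx_order])) ht
    have n₃ : ¬ S.IsBicentroid k e := fun ⟨t, ht, _⟩ => not_branch (Or.inl h₁) ht
    simp [h₁, h₁.not_nx_nx, n₁, n₂, n₃]
  by_cases h₂ : S.IsMonogon (S.nx (S.nx e))
  · have n₁ : ¬ S.IsHeavy k e := fun ⟨t, ht, _⟩ => not_branch (Or.inr h₂) ht
    have n₂ : ¬ S.IsHeavy k (S.op e) := fun ⟨t, ht, _⟩ =>
      not_branch (Or.inl (by rwa [h₂.op_eq])) ht
    have n₃ : ¬ S.IsBicentroid k e := fun ⟨t, ht, _⟩ => not_branch (Or.inr h₂) ht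
    simp [h₁, h₂, n₁, n₂, n₃]
  obtain ⟨a, b, ha, hb⟩ := hS.exists_pair h₁ h₂
  have := numNodes_of_pair hS ha hb
  simp only [ha.isHeavy_iff, hb.isHeavy_iff, ha.isBicentroid_iff, h₁, h₂]
  split_ifs <;> first | rfl | (exfalso; omega)

open Classical in
theorem heavy_add_heavy_nx_of_isMonogon (hS : S.EulerTwo) {k : ℕ}
    (hk : Nat.card S.E = 6 * (k + 1)) {e : S.E} (he : S.IsMonogon e) :
    ((if S.IsHeavy k e then 1 else 0) + (if S.IsHeavy k (S.nx e) then 1 else 0) +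
      (if S.IsHeavy k (S.nx (S.nx e)) then 1 else 0) : ℤ) =
      1 - (if S.IsCentroid k e then 1 else 0) := by
  have n₁ : ¬ S.IsHeavy k e := fun ⟨t, ht, _⟩ => not_branch (Or.inl he) ht
  have n₂ : ¬ S.IsHeavy k (S.nx e) := fun ⟨t, ht, _⟩ =>
    not_branch (Or.inr (by rwa [S.nx_order])) ht
  have n₃ : ¬ S.IsCentroid k e := fun ⟨t, _, _, h, _⟩ => not_branch (Or.inl he) h.1
  obtain ⟨a, b, ha, hb⟩ := hS.exists_pair (e := S.nx (S.nx e)) he.not_nx_nx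
    (by rw [S.nx_order]; exact he.not_nx)
  have hnil : S.Branch nil (S.op (S.nx (S.nx e))) := branch_nil_op.2 (by rwa [S.nx_order])
  have := numNodes_of_pair hS ha hnil
  have n₄ : S.IsHeavy k (S.nx (S.nx e)) := by
    rw [ha.isHeavy_iff]
    simp only [numNodes] at this
    omega
  simp [n₁, n₂, n₃, n₄]

open Classical in
theorem heavy_add_heavy_nx (hS : S.EulerTwo) {k : ℕ} (hk : Nat.card S.E = 6 * (k + 1)) (e : S.E) :
    ((if S.IsHeavy k e then 1 else 0) + (if S.IsHeavy k (S.nx e) then 1 else 0) +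
      (if S.IsHeavy k (S.nx (S.nx e)) then 1 else 0) : ℤ) =
      1 - (if S.IsCentroid k e then 1 else 0) := by
  by_cases h₁ : S.IsMonogon e
  · exact heavy_add_heavy_nx_of_isMonogon hS hk h₁
  by_cases h₂ : S.IsMonogon (S.nx e)
  · have := heavy_add_heavy_nx_of_isMonogon hS hk h₂
    simp only [S.nx_order, isCentroid_nx] at this
    linarith
  by_cases h₃ : S.IsMonogon (S.nx (S.nx e))
  · have := heavy_add_heavy_nx_of_isMonogon hS hk h₃
    simp only [S.nx_order, isCentroid_nx] at this
    linarith
  obtain ⟨a, ha⟩ := hS.isTreelike e h₁ h₃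
  obtain ⟨l, hl⟩ := hS.isTreelike (S.nx e) h₂ (by rwa [S.nx_order])
  obtain ⟨r, hr⟩ := hS.isTreelike (S.nx (S.nx e)) h₃ (by rwa [S.nx_order])
  have := numNodes_of_pair hS ha (b := node () l r) (branch_node_op.2 ⟨hl, hr⟩)
  simp only [numNodes] at this
  simp only [ha.isHeavy_iff, hl.isHeavy_iff, hr.isHeavy_iff, ha.isCentroid_iff hl hr]
  split_ifs <;> first | rfl | (exfalso; omega)

/-- A tree has either a bisecting edge or a centroid, and it is unique. -/
theorem card_isBicentroid_add_card_isCentroid (hS : S.EulerTwo) {k : ℕ}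
    (hk : Nat.card S.E = 6 * (k + 1)) :
    3 * Nat.card {e // S.IsBicentroid k e} + 2 * Nat.card {e // S.IsCentroid k e} = 6 := by
  classical
  have h₁ := Finset.sum_congr rfl fun e (_ : e ∈ Finset.univ) => heavy_add_heavy_op hS hk e
  have h₂ := Finset.sum_congr rfl fun e (_ : e ∈ Finset.univ) => heavy_add_heavy_nx hS hk e
  simp only [Finset.sum_add_distrib, Finset.sum_sub_distrib] at h₁ h₂
  rw [S.sum_op fun e => if S.IsHeavy k e then 1 else 0,
    S.sum_nx_nx fun e => if S.IsMonogon e then 1 else 0] at h₁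
  rw [S.sum_nx fun e => if S.IsHeavy k e then 1 else 0,
    S.sum_nx_nx fun e => if S.IsHeavy k e then 1 else 0] at h₂
  unfold EulerTwo at hS
  rw [Nat.card_eq_fintype_card] at hS
  simp only [Nat.card_eq_fintype_card, Fintype.card_subtype]
  zify
  simp only [Finset.sum_const, Finset.card_univ, nsmul_eq_mul, mul_one] at h₁ h₂
  rw [← Finset.sum_boole, ← Finset.sum_boole]
  linarith

theorem mem_ribbonAut {φ : Equiv.Perm S.E} : φ ∈ ribbonAut S ↔ IsHom S S φ := by
  rw [ribbonAut, Subgroup.mem_centralizer_iff]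
  simp only [Set.mem_insert_iff, Set.mem_singleton_iff, forall_eq_or_imp, forall_eq, IsHom]
  refine and_congr ?_ ?_ <;> rw [Equiv.ext_iff] <;> exact forall_congr' fun _ => eq_comm

theorem card_ribbonAut_congr {f : S.E ≃ S'.E} (hf : IsHom S S' f) :
    Nat.card (ribbonAut S) = Nat.card (ribbonAut S') := by
  refine Nat.card_congr (f.permCongr.subtypeEquiv fun φ => ?_)
  rw [mem_ribbonAut, mem_ribbonAut]
  constructor
  · exact fun h => hf.comp (h.comp hf.symm)
  · intro h
    convert hf.symm.comp (h.comp hf) using 1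
    ext
    simp

theorem card_range_mul_card_ribbonAut {X : S.E → Prop} {Y : Type*} (c : {e // X e} → Y)
    (hX : ∀ φ ∈ ribbonAut S, ∀ e, X e → X (φ e))
    (hc : ∀ x y, c x = c y ↔ ∃ φ ∈ ribbonAut S, φ x = (y : S.E)) :
    Nat.card (Set.range c) * Nat.card (ribbonAut S) = Nat.card {e // X e} := by
  rw [← Nat.card_prod]
  choose x hx using fun y : Set.range c => y.2
  refine Nat.card_congr (Equiv.ofBijective
    (fun p : Set.range c × ribbonAut S => ⟨p.2.1 (x p.1), hX _ p.2.2 _ (x p.1).2⟩) ⟨?_, ?_⟩)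
  · rintro ⟨y, φ, hφ⟩ ⟨y', φ', hφ'⟩ h
    have h : φ (x y) = φ' (x y') := congrArg Subtype.val h
    have hy : y = y' := by
      rw [Subtype.ext_iff, ← hx, ← hx, hc]
      exact ⟨φ'⁻¹ * φ, mul_mem (inv_mem hφ') hφ, by simp [h]⟩
    subst hy
    have := (mem_ribbonAut.1 hφ).eq_of_apply_eq (mem_ribbonAut.1 hφ') h
    simp only [Prod.mk.injEq, Subtype.mk.injEq, true_and]
    exact Equiv.coe_fn_injective this
  · intro e
    obtain ⟨φ, hφ, h⟩ := (hc (x ⟨c e, e, rfl⟩) e).1 (hx _)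
    exact ⟨⟨⟨c e, e, rfl⟩, φ, hφ⟩, Subtype.ext h⟩

theorem card_ribbonAut_dvd {X : S.E → Prop} (hX : ∀ φ ∈ ribbonAut S, ∀ e, X e → X (φ e)) :
    Nat.card (ribbonAut S) ∣ Nat.card {e // X e} := by
  let s : Setoid {e // X e} :=
    { r x y := ∃ φ ∈ ribbonAut S, φ x = (y : S.E)
      iseqv := ⟨fun x => ⟨1, one_mem _, rfl⟩,
        fun {x y} ⟨φ, hφ, h⟩ => ⟨φ⁻¹, inv_mem hφ, by simp [← h]⟩,
        fun {x y z} ⟨φ, hφ, h⟩ ⟨ψ, hψ, h'⟩ => ⟨ψ * φ, mul_mem hψ hφ, by simp [h, h']⟩⟩ }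
  rw [← card_range_mul_card_ribbonAut (Quotient.mk s) hX fun x y => Quotient.eq]
  exact Dvd.intro_left _ rfl

theorem equivalence_sptIso (k : ℕ) : Equivalence (@SPTIso k) where
  refl _ := ⟨Equiv.refl _, fun _ => rfl, fun _ => rfl⟩
  symm := fun ⟨f, hf⟩ => ⟨f.symm, IsHom.symm hf⟩
  trans := fun ⟨f, hf⟩ ⟨g, hg⟩ => ⟨f.trans g, IsHom.comp hg hf⟩

theorem equivalence_optIso (k : ℕ) : Equivalence (@OPTIso k) where
  refl _ := ⟨Equiv.refl _, fun _ => rfl, fun _ => rfl, rfl⟩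
  symm := fun ⟨f, hf, hf', h⟩ => ⟨f.symm, (IsHom.symm ⟨hf, hf'⟩).1, (IsHom.symm ⟨hf, hf'⟩).2,
    (Equiv.symm_apply_eq f).2 h.symm⟩
  trans := fun ⟨f, hf, hf', h⟩ ⟨g, hg, hg', h'⟩ => ⟨f.trans g,
    (IsHom.comp ⟨hg, hg'⟩ ⟨hf, hf'⟩).1, (IsHom.comp ⟨hg, hg'⟩ ⟨hf, hf'⟩).2,
    (congrArg g h).trans h'⟩

theorem _root_.SizedPseudoTree.eulerTwo {k : ℕ} (A : SizedPseudoTree k) : A.Sk.EulerTwo :=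
  isPseudoTree_iff.1 A.isPT

/-- The order of the automorphism group of an isomorphism class. -/
noncomputable def autCard {k : ℕ} : Quot (@SPTIso k) → ℕ :=
  Quot.lift (fun A => Nat.card (ribbonAut A.Sk)) fun _ _ ⟨_, hf⟩ => card_ribbonAut_congr hf

theorem autCard_pos {k : ℕ} (q : Quot (@SPTIso k)) : 0 < autCard q := by
  induction q using Quot.ind
  exact Nat.card_pos

/-- Double counting of elements of pseudo-trees up to isomorphism. -/
theorem card_eq_sum_div_autCard {k m : ℕ} [Fintype (Quot (@SPTIso k))] {Y : Type*}
    (X : ∀ S : ThreeSkeleton, S.E → Prop)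
    (hX : ∀ {S S' : ThreeSkeleton} (f : S.E ≃ S'.E), IsHom S S' f → ∀ e, X S e → X S' (f e))
    (hm : ∀ A : SizedPseudoTree k, Nat.card {e // X A.Sk e} = m)
    (c : ∀ A : SizedPseudoTree k, {e // X A.Sk e} → Y)
    (hc : ∀ A B x y, c A x = c B y ↔ ∃ f : A.Sk.E ≃ B.Sk.E, IsHom A.Sk B.Sk f ∧ f x = (y : B.Sk.E))
    (hsurj : ∀ y, ∃ A x, c A x = y) :
    (Nat.card Y : ℚ) = ∑ q : Quot (@SPTIso k), (m : ℚ) / autCard q := by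
  choose A x hx using hsurj
  let π : Y → Quot (@SPTIso k) := fun y => Quot.mk _ (A y)
  have hπ : ∀ B, {y | π y = Quot.mk _ B} = Set.range (c B) := by
    intro B
    ext y
    simp only [π, Set.mem_ofPred_eq, Set.mem_range, (equivalence_sptIso k).quot_mk_eq_iff]
    constructor
    · rintro ⟨f, hf⟩
      refine ⟨⟨f (x y), hX f hf _ (x y).2⟩, ?_⟩
      exact ((hc _ _ _ _).2 ⟨f, hf, rfl⟩).symm.trans (hx y)
    · rintro ⟨e, rfl⟩
      obtain ⟨f, hf, -⟩ := (hc _ _ _ _).1 (hx (c B e))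
      exact ⟨f, hf⟩
  have hfin : ∀ q, Finite {y // π y = q} := by
    intro q
    induction q using Quot.ind with | mk B =>
    change Finite {y | π y = Quot.mk _ B}
    rw [hπ]
    infer_instance
  rw [← Nat.card_congr (Equiv.sigmaFiberEquiv π), Nat.card_sigma, Nat.cast_sum]
  refine Finset.sum_congr rfl fun q _ => ?_
  rw [eq_div_iff (by exact_mod_cast (autCard_pos q).ne')]
  induction q using Quot.ind with | mk B =>
  change (Nat.card {y | π y = Quot.mk _ B} : ℚ) * (Nat.card (ribbonAut B.Sk) : ℕ) = m
  rw [hπ, ← Nat.cast_mul, card_range_mul_card_ribbonAut (c B), hm]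
  · exact fun φ hφ e he => hX φ (mem_ribbonAut.1 hφ) e he
  · intro e e'
    rw [hc]
    exact exists_congr fun φ => and_congr_left' mem_ribbonAut.symm

theorem isMonogon_iff {f : S.E ≃ S'.E} (hf : IsHom S S' f) {e : S.E} :
    S'.IsMonogon (f e) ↔ S.IsMonogon e :=
  ⟨fun h => by simpa using hf.symm.monogon h, hf.monogon⟩

theorem isBicentroid_iff {f : S.E ≃ S'.E} (hf : IsHom S S' f) {k : ℕ} {e : S.E} :
    S'.IsBicentroid k (f e) ↔ S.IsBicentroid k e :=
  ⟨fun ⟨t, h, hk⟩ => ⟨t, by simpa using hf.symm.branch h, hk⟩, fun ⟨t, h, hk⟩ =>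
    ⟨t, hf.branch h, hk⟩⟩

theorem IsCentroid.map {f : S.E ≃ S'.E} (hf : IsHom S S' f) {k : ℕ} {e : S.E}
    (h : S.IsCentroid k e) : S'.IsCentroid k (f e) := by
  obtain ⟨t₀, t₁, t₂, ⟨h₀, h₁, h₂⟩, hk⟩ := h
  refine ⟨t₀, t₁, t₂, ⟨hf.branch h₀, ?_, ?_⟩, hk⟩
  · rw [← hf.2]
    exact hf.branch h₁
  · rw [← hf.2, ← hf.2]
    exact hf.branch h₂

theorem card_ribbonAut_dvd_isBicentroid (S : ThreeSkeleton) (k : ℕ) :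
    Nat.card (ribbonAut S) ∣ Nat.card {e // S.IsBicentroid k e} :=
  card_ribbonAut_dvd fun _ hφ _ => (isBicentroid_iff (mem_ribbonAut.1 hφ)).2

theorem card_ribbonAut_dvd_isCentroid (S : ThreeSkeleton) (k : ℕ) :
    Nat.card (ribbonAut S) ∣ Nat.card {e // S.IsCentroid k e} :=
  card_ribbonAut_dvd fun _ hφ _ => IsCentroid.map (mem_ribbonAut.1 hφ)

theorem card_isBicentroid_or_card_isCentroid (hS : S.EulerTwo) {k : ℕ}
    (hk : Nat.card S.E = 6 * (k + 1)) :
    Nat.card {e // S.IsBicentroid k e} = 2 ∧ Nat.card {e // S.IsCentroid k e} = 0 ∨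
      Nat.card {e // S.IsBicentroid k e} = 0 ∧ Nat.card {e // S.IsCentroid k e} = 3 := by
  have := card_isBicentroid_add_card_isCentroid hS hk
  omega

theorem card_ribbonAut_eq (hS : S.EulerTwo) {k : ℕ} (hk : Nat.card S.E = 6 * (k + 1)) :
    Nat.card (ribbonAut S) = 1 ∨ Nat.card (ribbonAut S) = 2 ∨ Nat.card (ribbonAut S) = 3 := by
  have h₁ := S.card_ribbonAut_dvd_isBicentroid k
  have h₂ := S.card_ribbonAut_dvd_isCentroid k
  rcases card_isBicentroid_or_card_isCentroid hS hk with ⟨h, -⟩ | ⟨-, h⟩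
  · rw [h, Nat.dvd_prime Nat.prime_two] at h₁
    tauto
  · rw [h, Nat.dvd_prime Nat.prime_three] at h₂
    tauto

theorem card_isMonogon (hS : S.EulerTwo) {k : ℕ} (hk : Nat.card S.E = 6 * (k + 1)) :
    Nat.card {e // S.IsMonogon e} = k + 2 := by
  have := eulerTwo_iff.1 hS
  simp only [z_eq_iff] at this
  omega

theorem exists_branch_of_stalk (hS : S.EulerTwo) {k : ℕ} (hk : Nat.card S.E = 6 * (k + 1)) {s : S.E}
    (hs : S.IsMonogon (S.nx s)) : ∃ t, S.Branch t s ∧ t.numNodes = k := by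
  have h₁ : ¬ S.IsMonogon s := fun h => h.not_nx hs
  obtain ⟨t, ht⟩ := hS.isTreelike s h₁ hs.not_nx
  have := numNodes_of_pair hS ht (branch_nil_op.2 hs)
  simp only [numNodes] at this
  exact ⟨t, ht, by omega⟩

/-- The pseudo-tree of a plane binary tree with `k` nodes. -/
def sized {k : ℕ} (t : {t : BinaryTree Unit // t.numNodes = k}) : SizedPseudoTree k :=
  ⟨t.1.skeleton, t.1.eulerTwo_skeleton.isPseudoTree, t.1.card_skeleton.trans (by rw [t.2])⟩

theorem equiv_treesOfNumNodesEq (k : ℕ) :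
    Nonempty ({t : BinaryTree Unit // t.numNodes = k} ≃ treesOfNumNodesEq k) :=
  ⟨Equiv.subtypeEquivRight fun _ => mem_treesOfNumNodesEq.symm⟩

theorem card_numNodes_eq (k : ℕ) :
    Nat.card {t : BinaryTree Unit // t.numNodes = k} = catalan k := by
  rw [Nat.card_congr (equiv_treesOfNumNodesEq k).some, Nat.card_eq_fintype_card,
    Fintype.card_coe, treesOfNumNodesEq_card_eq_catalan]

instance (k : ℕ) : Finite (Quot (@SPTIso k)) := by
  have := Finite.of_equiv _ (equiv_treesOfNumNodesEq k).some.symm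
  refine Finite.of_surjective (fun t : {t : BinaryTree Unit // t.numNodes = k} =>
    Quot.mk SPTIso (sized t)) fun q => ?_
  induction q using Quot.ind with | mk A =>
  obtain ⟨s, -, hs, -⟩ := A.eulerTwo.exists_stalk
  obtain ⟨t, ht, hk⟩ := exists_branch_of_stalk A.eulerTwo A.size hs
  obtain ⟨f, hf, -⟩ := exists_equiv_skeleton A.eulerTwo hs ht
  exact ⟨⟨t, hk⟩, Quot.sound ⟨f, hf⟩⟩

noncomputable instance (k : ℕ) : Fintype (Quot (@SPTIso k)) := Fintype.ofFinite _

theorem catalan_eq_sum (k : ℕ) :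
    (catalan k : ℚ) = ∑ q : Quot (@SPTIso k), ((k + 2 : ℕ) : ℚ) / autCard q := by
  have ex : ∀ (A : SizedPseudoTree k) (x : {e // A.Sk.IsMonogon (A.Sk.nx e)}),
      ∃ t : {t : BinaryTree Unit // t.numNodes = k}, A.Sk.Branch t x := fun A x => by
    obtain ⟨t, ht, hk⟩ := exists_branch_of_stalk A.eulerTwo A.size x.2
    exact ⟨⟨t, hk⟩, ht⟩
  choose c hc using ex
  rw [← card_numNodes_eq]
  refine card_eq_sum_div_autCard (fun S e => S.IsMonogon (S.nx e)) ?_ ?_ c ?_ ?_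
  · intro S S' f hf e he
    rw [← hf.2]
    exact hf.monogon he
  · intro A
    rw [← card_isMonogon A.eulerTwo A.size]
    exact Nat.card_congr (A.Sk.nx.subtypeEquiv fun _ => Iff.rfl)
  · intro A B x y
    constructor
    · intro h
      have hx := hc A x
      rw [h] at hx
      exact exists_equiv_of_pair A.eulerTwo B.eulerTwo hx (branch_nil_op.2 x.2) (hc B y)
        (branch_nil_op.2 y.2)
    · rintro ⟨f, hf, h⟩
      have := hf.branch (hc A x)
      rw [h] at this
      exact Subtype.ext (this.unique (hc B y))
  · intro t
    exact ⟨sized t, ⟨Sum.inl 0, t.1.isMonogon_skeleton⟩,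
      Subtype.ext ((hc (sized t) _).unique t.1.branch_skeleton)⟩

theorem ttildeNum_eq_sum (k : ℕ) :
    (TtildeNum k : ℚ) = ∑ q : Quot (@SPTIso k), ((5 * k + 4 : ℕ) : ℚ) / autCard q := by
  refine card_eq_sum_div_autCard (fun S e => S.z e ≠ e) ?_ ?_
    (fun A x => Quot.mk _ ⟨A.Sk, A.isPT, A.size, x, x.2⟩) ?_ ?_
  · intro S S' f hf e he
    rwa [Ne, z_eq_iff, isMonogon_iff hf, ← z_eq_iff]
  · intro A
    classical
    have h₁ := card_isMonogon A.eulerTwo A.size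
    have h₂ := A.size
    simp only [Ne, z_eq_iff, Nat.card_eq_fintype_card] at h₁ h₂ ⊢
    rw [Fintype.card_subtype_compl, h₁, h₂]
    omega
  · intro A B x y
    rw [(equivalence_optIso k).quot_mk_eq_iff]
    exact exists_congr fun _ => and_assoc.symm
  · intro q
    induction q using Quot.ind with | mk A =>
    exact ⟨⟨A.Sk, A.isPT, A.size⟩, ⟨A.pt, A.outer⟩, rfl⟩

theorem tNum_eq_sum (k i : ℕ) :
    (TNum k i : ℚ) = ∑ q : Quot (@SPTIso k), if autCard q = i then 1 else 0 := by
  rw [Finset.sum_boole, ← Fintype.card_subtype, ← Nat.card_eq_fintype_card, TNum]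
  congr 1
  refine Nat.card_congr (Equiv.ofBijective
    (Quot.lift (fun A => ⟨Quot.mk _ A.1, A.2⟩) fun A B h => Subtype.ext (Quot.sound h)) ⟨?_, ?_⟩)
  · intro q q' h
    induction q using Quot.ind
    induction q' using Quot.ind
    exact Quot.sound ((equivalence_sptIso k).quot_mk_eq_iff _ _ |>.1 (congrArg Subtype.val h))
  · rintro ⟨q, hq⟩
    induction q using Quot.ind with | mk A =>
    exact ⟨Quot.mk _ ⟨A, hq⟩, rfl⟩

theorem sum_inv_autCard (k : ℕ) :
    ∑ q : Quot (@SPTIso k), (1 : ℚ) / autCard q = catalan k / (k + 2) := by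
  have h : (k + 2 : ℚ) ≠ 0 := by positivity
  rw [eq_div_iff h, catalan_eq_sum, Finset.sum_mul]
  refine Finset.sum_congr rfl fun q _ => ?_
  push_cast
  ring

theorem tcount_eq (k : ℕ) :
    (Tcount k : ℚ) = catalan k / (k + 2) + (TNum k 2 : ℚ) / 2 + 2 * (TNum k 3 : ℚ) / 3 := by
  rw [← sum_inv_autCard, tNum_eq_sum, tNum_eq_sum, Tcount, Nat.card_eq_fintype_card,
    Fintype.card_eq_sum_ones, Finset.sum_div, Finset.mul_sum, Finset.sum_div,
    ← Finset.sum_add_distrib, ← Finset.sum_add_distrib]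
  push_cast
  refine Finset.sum_congr rfl fun q _ => ?_
  have : autCard q = 1 ∨ autCard q = 2 ∨ autCard q = 3 := by
    induction q using Quot.ind with | mk A =>
    exact card_ribbonAut_eq A.eulerTwo A.size
  rcases this with h | h | h <;> norm_num [h]

theorem ttildeNum_eq (k : ℕ) :
    (TtildeNum k : ℚ) = (5 * k + 4) * (catalan k : ℚ) / (k + 2) := by
  rw [ttildeNum_eq_sum, mul_div_assoc, ← sum_inv_autCard, Finset.mul_sum]
  refine Finset.sum_congr rfl fun q _ => ?_
  push_cast
  ring

theorem one_lt_card_ribbonAut {φ : Equiv.Perm S.E} (hφ : IsHom S S φ) {e : S.E} (h : φ e ≠ e) :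
    1 < Nat.card (ribbonAut S) := by
  rw [Finite.one_lt_card_iff_nontrivial, Subgroup.nontrivial_iff_exists_ne_one]
  exact ⟨φ, mem_ribbonAut.2 hφ, fun h' => h (by rw [h']; rfl)⟩

theorem exists_isHom_apply_ne (h : 1 < Nat.card (ribbonAut S)) :
    ∃ φ : Equiv.Perm S.E, IsHom S S φ ∧ ∀ e, φ e ≠ e := by
  rw [Finite.one_lt_card_iff_nontrivial, Subgroup.nontrivial_iff_exists_ne_one] at h
  obtain ⟨φ, hφ, h⟩ := h
  rw [mem_ribbonAut] at hφ
  have h1 : IsHom S S (1 : Equiv.Perm S.E) := ⟨fun _ => rfl, fun _ => rfl⟩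
  exact ⟨φ, hφ, fun e he => h (Equiv.coe_fn_injective (hφ.eq_of_apply_eq h1 he))⟩

theorem IsBicentroid.op (hS : S.EulerTwo) {k : ℕ} (hk : Nat.card S.E = 6 * (k + 1)) {e : S.E}
    (h : S.IsBicentroid k e) : S.IsBicentroid k (S.op e) := by
  obtain ⟨t, ht, h⟩ := h
  obtain ⟨a, b, ha, hb⟩ := hS.exists_pair (fun h => not_branch (Or.inl h) ht)
    (fun h => not_branch (Or.inr h) ht)
  have := numNodes_of_pair hS ht hb
  exact ⟨b, hb, by omega⟩

theorem IsBicentroid.card_eq (hS : S.EulerTwo) {k : ℕ} (hk : Nat.card S.E = 6 * (k + 1)) {e : S.E}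
    (h : S.IsBicentroid k e) : Nat.card {e // S.IsBicentroid k e} = 2 := by
  have : Nonempty {e // S.IsBicentroid k e} := ⟨⟨e, h⟩⟩
  have := Nat.card_pos (α := {e // S.IsBicentroid k e})
  have := card_isBicentroid_or_card_isCentroid hS hk
  omega

theorem IsCentroid.card_eq (hS : S.EulerTwo) {k : ℕ} (hk : Nat.card S.E = 6 * (k + 1)) {e : S.E}
    (h : S.IsCentroid k e) : Nat.card {e // S.IsCentroid k e} = 3 := by
  have : Nonempty {e // S.IsCentroid k e} := ⟨⟨e, h⟩⟩
  have := Nat.card_pos (α := {e // S.IsCentroid k e})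
  have := card_isBicentroid_or_card_isCentroid hS hk
  omega

theorem IsBicentroid.eq_or_eq (hS : S.EulerTwo) {k : ℕ} (hk : Nat.card S.E = 6 * (k + 1))
    {e e' : S.E} (h : S.IsBicentroid k e) (h' : S.IsBicentroid k e') : e' = e ∨ e' = S.op e := by
  classical
  by_contra! hne
  have hc := h.card_eq hS hk
  rw [Nat.card_eq_fintype_card, Fintype.card_subtype] at hc
  have hsub : ({e', e, S.op e} : Finset S.E) ⊆ Finset.univ.filter (S.IsBicentroid k) := by
    simp [Finset.insert_subset_iff, h, h', h.op hS hk]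
  have := Finset.card_le_card hsub
  rw [hc, Finset.card_eq_three.2 ⟨_, _, _, hne.1, hne.2, (S.op_free e).symm, rfl⟩] at this
  omega

theorem IsCentroid.eq_or_eq (hS : S.EulerTwo) {k : ℕ} (hk : Nat.card S.E = 6 * (k + 1))
    {e e' : S.E} (h : S.IsCentroid k e) (h' : S.IsCentroid k e') :
    e' = e ∨ e' = S.nx e ∨ e' = S.nx (S.nx e) := by
  classical
  by_contra! hne
  have hc := h.card_eq hS hk
  rw [Nat.card_eq_fintype_card, Fintype.card_subtype] at hc
  have hsub : ({e', e, S.nx e, S.nx (S.nx e)} : Finset S.E) ⊆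
      Finset.univ.filter (S.IsCentroid k) := by
    simp [Finset.insert_subset_iff, h, h', h.nx, h.nx.nx]
  have := Finset.card_le_card hsub
  rw [hc, Finset.card_insert_of_notMem (by simp [hne]), Finset.card_eq_three.2
    ⟨_, _, _, (S.nx_free e).symm, (nx_nx_ne e).symm, (S.nx_free _).symm, rfl⟩] at this
  omega

theorem tNum_eq_card {k i : ℕ} {Y : Type*} (W : ThreeSkeleton → Y → Prop)
    (hex : ∀ y, ∃ A : SizedPseudoTree k, W A.Sk y)
    (haut : ∀ (A : SizedPseudoTree k) y, W A.Sk y → Nat.card (ribbonAut A.Sk) = i)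
    (hconv : ∀ A : SizedPseudoTree k, Nat.card (ribbonAut A.Sk) = i → ∃ y, W A.Sk y)
    (huniq : ∀ (A B : SizedPseudoTree k) y y', SPTIso A B → W A.Sk y → W B.Sk y' → y = y')
    (hW : ∀ (A B : SizedPseudoTree k) y, W A.Sk y → W B.Sk y → SPTIso A B) :
    TNum k i = Nat.card Y := by
  choose A hA using hex
  let r (A B : {S : SizedPseudoTree k // Nat.card (ribbonAut S.Sk) = i}) : Prop := SPTIso A.1 B.1
  have hr : Equivalence r := (equivalence_sptIso k).comap Subtype.val
  refine (Nat.card_congr (Equiv.ofBijective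
    (fun y => Quot.mk r ⟨A y, haut _ y (hA y)⟩) ⟨fun y y' h => ?_, fun q => ?_⟩)).symm
  · exact huniq _ _ _ _ ((hr.quot_mk_eq_iff _ _).1 h) (hA y) (hA y')
  · induction q using Quot.ind with | mk B =>
    obtain ⟨y, hy⟩ := hconv B.1 B.2
    exact ⟨y, Quot.sound (hW (A y) B.1 y (hA y) hy)⟩

theorem tNum_two (k : ℕ) :
    TNum k 2 = Nat.card {t : BinaryTree Unit // 2 * t.numNodes = k} := by
  refine tNum_eq_card (fun S t => ∃ e, S.Branch t.1 e ∧ S.Branch t.1 (S.op e)) ?_ ?_ ?_ ?_ ?_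
  · rintro ⟨t, rfl⟩
    obtain ⟨S, e, hS, hc, he⟩ := exists_of_pair t t
    exact ⟨⟨S, hS.isPseudoTree, by rw [hc, two_mul]⟩, e, he⟩
  · rintro A ⟨t, hk⟩ ⟨e, h₁, h₂⟩
    have hdvd := A.Sk.card_ribbonAut_dvd_isBicentroid k
    rw [IsBicentroid.card_eq A.eulerTwo A.size ⟨t, h₁, hk⟩, Nat.dvd_prime Nat.prime_two] at hdvd
    obtain ⟨f, hf, h⟩ := exists_equiv_of_pair A.eulerTwo A.eulerTwo h₁ h₂ h₂
      (by rwa [A.Sk.op_invol])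
    have := one_lt_card_ribbonAut hf (h.trans_ne (A.Sk.op_free e))
    omega
  · intro A hA
    obtain ⟨φ, hφ, hne⟩ := exists_isHom_apply_ne (S := A.Sk) (by omega)
    have hc : 0 < Nat.card {e // A.Sk.IsBicentroid k e} := by
      have hdvd := A.Sk.card_ribbonAut_dvd_isCentroid k
      rw [hA] at hdvd
      have := card_isBicentroid_or_card_isCentroid A.eulerTwo A.size
      omega
    obtain ⟨⟨e, he⟩⟩ := (Nat.card_pos_iff.1 hc).1
    have h := (he.eq_or_eq A.eulerTwo A.size ((isBicentroid_iff hφ).2 he)).resolve_left (hne e)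
    obtain ⟨t, ht, hk⟩ := he
    exact ⟨⟨t, hk⟩, e, ht, h ▸ hφ.branch ht⟩
  · rintro A B ⟨t, hk⟩ ⟨t', hk'⟩ ⟨f, hf⟩ ⟨e, h₁, -⟩ ⟨e', h₁', h₂'⟩
    have hb : B.Sk.IsBicentroid k (f e) := (isBicentroid_iff hf).2 ⟨t, h₁, hk⟩
    have h := IsHom.branch hf h₁
    refine Subtype.ext ?_
    rcases IsBicentroid.eq_or_eq B.eulerTwo B.size ⟨t', h₁', hk'⟩ hb with h' | h' <;> rw [h'] at h
    · exact h.unique h₁'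
    · exact h.unique h₂'
  · rintro A B t ⟨e, h₁, h₂⟩ ⟨e', h₁', h₂'⟩
    obtain ⟨f, hf, -⟩ := exists_equiv_of_pair A.eulerTwo B.eulerTwo h₁ h₂ h₁' h₂'
    exact ⟨f, hf⟩

theorem tNum_three (k : ℕ) :
    TNum k 3 = Nat.card {t : BinaryTree Unit // 3 * t.numNodes + 1 = k} := by
  have hcent : ∀ {S : ThreeSkeleton} {t : BinaryTree Unit} {e : S.E}, 3 * t.numNodes + 1 = k →
      S.Branch t e ∧ S.Branch t (S.nx e) ∧ S.Branch t (S.nx (S.nx e)) → S.IsCentroid k e :=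
    fun hk h => ⟨_, _, _, h, by omega, by omega, by omega⟩
  refine tNum_eq_card (fun S t => ∃ e, S.Branch t.1 e ∧ S.Branch t.1 (S.nx e) ∧
    S.Branch t.1 (S.nx (S.nx e))) ?_ ?_ ?_ ?_ ?_
  · rintro ⟨t, rfl⟩
    obtain ⟨S, e, hS, hc, h₁, h₂⟩ := exists_of_pair t (node () t t)
    refine ⟨⟨S, hS.isPseudoTree, ?_⟩, e, h₁, branch_node_op.1 h₂⟩
    rw [hc]
    simp only [numNodes]
    ring
  · rintro A ⟨t, hk⟩ ⟨e, h₁, h₂, h₃⟩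
    have hdvd := A.Sk.card_ribbonAut_dvd_isCentroid k
    rw [(hcent hk ⟨h₁, h₂, h₃⟩).card_eq A.eulerTwo A.size, Nat.dvd_prime Nat.prime_three] at hdvd
    obtain ⟨f, hf, h⟩ := exists_equiv_of_pair A.eulerTwo A.eulerTwo h₁
      (branch_node_op (u := ()).2 ⟨h₂, h₃⟩) h₂ (branch_node_op.2 ⟨h₃, by rwa [A.Sk.nx_order]⟩)
    have := one_lt_card_ribbonAut hf (h.trans_ne (A.Sk.nx_free e))
    omega
  · intro A hA
    obtain ⟨φ, hφ, hne⟩ := exists_isHom_apply_ne (S := A.Sk) (by omega)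
    have hc : 0 < Nat.card {e // A.Sk.IsCentroid k e} := by
      have hdvd := A.Sk.card_ribbonAut_dvd_isBicentroid k
      rw [hA] at hdvd
      have := card_isBicentroid_or_card_isCentroid A.eulerTwo A.size
      omega
    obtain ⟨⟨e, he⟩⟩ := (Nat.card_pos_iff.1 hc).1
    have h := (he.eq_or_eq A.eulerTwo A.size (he.map hφ)).resolve_left (hne e)
    obtain ⟨t, t₁, t₂, ⟨h₀, h₁, h₂⟩, -⟩ := he
    have hcard := numNodes_of_pair A.eulerTwo h₀ (branch_node_op (u := ()).2 ⟨h₁, h₂⟩)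
    have h₀' := hφ.branch h₀
    have h₁' := hφ.branch h₁
    obtain ⟨rfl, rfl⟩ : t₁ = t ∧ t₂ = t := by
      rw [hφ.2] at h₁'
      rcases h with h | h <;> rw [h] at h₀' h₁'
      · obtain rfl := h₁.unique h₀'
        exact ⟨rfl, h₂.unique h₁'⟩
      · rw [A.Sk.nx_order] at h₁'
        exact ⟨h₁'.unique h₀, h₂.unique h₀'⟩
    rw [A.size] at hcard
    simp only [numNodes] at hcard
    exact ⟨⟨_, by omega⟩, e, h₀, h₁, h₂⟩
  · rintro A B ⟨t, hk⟩ ⟨t', hk'⟩ ⟨f, hf⟩ ⟨e, he⟩ ⟨e', he'⟩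
    have h := IsHom.branch hf he.1
    refine Subtype.ext ?_
    rcases (hcent hk' he').eq_or_eq B.eulerTwo B.size ((hcent hk he).map hf) with h' | h' | h' <;>
      rw [h'] at h
    · exact h.unique he'.1
    · exact h.unique he'.2.1
    · exact h.unique he'.2.2
  · rintro A B t ⟨e, h₁, h₂⟩ ⟨e', h₁', h₂'⟩
    obtain ⟨f, hf, -⟩ := exists_equiv_of_pair A.eulerTwo B.eulerTwo h₁
      (branch_node_op (u := ()).2 h₂) h₁' (branch_node_op.2 h₂')
    exact ⟨f, hf⟩

end ThreeSkeleton

theorem stmt_18 (k : ℕ) :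
    (Tcount k : ℚ) =
      (catalan k : ℚ) / (k + 2) + (TNum k 2 : ℚ) / 2 + 2 * (TNum k 3 : ℚ) / 3 ∧
    (TtildeNum k : ℚ) = (5 * k + 4) * (catalan k : ℚ) / (k + 2) ∧
    TNum k 2 = (if 2 ∣ k then catalan (k / 2) else 0) ∧
    TNum k 3 = (if k % 3 = 1 then catalan ((k - 1) / 3) else 0) := by
  refine ⟨ThreeSkeleton.tcount_eq k, ThreeSkeleton.ttildeNum_eq k, ?_, ?_⟩
  · rw [ThreeSkeleton.tNum_two]
    split_ifs with h
    · rw [← ThreeSkeleton.card_numNodes_eq]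
      exact Nat.card_congr (Equiv.subtypeEquivRight fun t => by omega)
    · rw [Nat.card_eq_zero]
      exact Or.inl ⟨fun t => h (by have := t.2; omega)⟩
  · rw [ThreeSkeleton.tNum_three]
    split_ifs with h
    · rw [← ThreeSkeleton.card_numNodes_eq]
      exact Nat.card_congr (Equiv.subtypeEquivRight fun t => by omega)
    · rw [Nat.card_eq_zero]
      exact Or.inl ⟨fun t => h (by have := t.2; omega)⟩
end

section
/- For two generalized pseudo-trees, the associated monodromies at infinity — products ∏ᵢ (XY)^{m_i−1}X in PSL(2,ℤ) over the cyclic sequences (m_i) with all m_i ≥ 2 — are conjugate in PSL(2,ℤ) if and only if the sequences (m'_i) and (m''_j) differ by a cyclic permutation. -/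
/-- `SL(2,ℤ)`. -/
abbrev SL2Z := Matrix.SpecialLinearGroup (Fin 2) ℤ

/-- The matrix `X = [[-1,1],[-1,0]]`, of order 3 in `PSL(2,ℤ)`. -/
def Xm : SL2Z := ⟨!![(-1 : ℤ), 1; -1, 0], by norm_num [Matrix.det_fin_two_of]⟩

/-- The matrix `Y = [[0,-1],[1,0]]`, of order 2 in `PSL(2,ℤ)`. -/
def Ym : SL2Z := ⟨!![(0 : ℤ), -1; 1, 0], by norm_num [Matrix.det_fin_two_of]⟩

/-- The modular group `PSL(2,ℤ) = SL(2,ℤ)/{±1}`. -/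
abbrev PSL2Z := SL2Z ⧸ Subgroup.center SL2Z

/-- The image of `X` in `PSL(2,ℤ)`. -/
def Xb : PSL2Z := QuotientGroup.mk Xm

/-- The image of `Y` in `PSL(2,ℤ)`. -/
def Yb : PSL2Z := QuotientGroup.mk Ym

/-- The monodromy at infinity associated to a sequence `(m₁, …, m_n)`:
the right-to-left product `(XY)^{m_n−1}X ⋯ (XY)^{m₂−1}X (XY)^{m₁−1}X ∈ PSL(2,ℤ)`. -/
def W (l : List ℕ) : PSL2Z :=
  (l.reverse.map fun m => (Xb * Yb) ^ (m - 1) * Xb).prod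

/-- The elementary matrices `[[1,1],[0,1]]` (for `true`) and `[[1,0],[1,1]]` (for `false`). -/
def elemMat : Bool → SL2Z
  | true => ⟨!![1, 1; 0, 1], by norm_num [Matrix.det_fin_two_of]⟩
  | false => ⟨!![1, 0; 1, 1], by norm_num [Matrix.det_fin_two_of]⟩

/-- The product of the elementary matrices spelled by a word. -/
def wordMat (u : List Bool) : SL2Z := (u.map elemMat).prod

/-- The word `true^k₁ false true^k₂ false ⋯` spelled by a list of exponents. -/
def code (l : List ℕ) : List Bool := l.flatMap fun k => List.replicate k true ++ [false]

lemma wordMat_nil : wordMat [] = 1 := rfl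

lemma wordMat_cons (x : Bool) (u : List Bool) : wordMat (x :: u) = elemMat x * wordMat u := by
  simp [wordMat]

lemma wordMat_append (u v : List Bool) : wordMat (u ++ v) = wordMat u * wordMat v := by
  simp [wordMat]

lemma SL2Z.mul_apply (x y : SL2Z) (i j : Fin 2) :
    (x * y) i j = x i 0 * y 0 j + x i 1 * y 1 j := by
  simp [Matrix.mul_apply, Fin.sum_univ_two]

lemma elemMat_true_mul (g : SL2Z) (j : Fin 2) :
    (elemMat true * g) 0 j = g 0 j + g 1 j ∧ (elemMat true * g) 1 j = g 1 j := by
  simp only [SL2Z.mul_apply]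
  simp [elemMat]

lemma elemMat_false_mul (g : SL2Z) (j : Fin 2) :
    (elemMat false * g) 0 j = g 0 j ∧ (elemMat false * g) 1 j = g 0 j + g 1 j := by
  simp only [SL2Z.mul_apply]
  simp [elemMat]

lemma SL2Z.det_eq (g : SL2Z) : g 0 0 * g 1 1 - g 0 1 * g 1 0 = 1 := by
  rw [← Matrix.det_fin_two, g.det_coe]

lemma SL2Z.ext_entries {g h : SL2Z} (h00 : g 0 0 = h 0 0) (h01 : g 0 1 = h 0 1)
    (h10 : g 1 0 = h 1 0) (h11 : g 1 1 = h 1 1) : g = h := by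
  ext i j
  fin_cases i <;> fin_cases j <;> assumption

lemma wordMat_entries (u : List Bool) :
    1 ≤ wordMat u 0 0 ∧ 0 ≤ wordMat u 0 1 ∧ 0 ≤ wordMat u 1 0 ∧ 1 ≤ wordMat u 1 1 := by
  induction u with
  | nil => simp [wordMat_nil]
  | cons x u ih =>
    rw [wordMat_cons]
    cases x
    · simp only [elemMat_false_mul]; omega
    · simp only [elemMat_true_mul]; omega

lemma wordMat_lower_left_pos {u : List Bool} (hu : false ∈ u) : 0 < wordMat u 1 0 := by
  induction u with
  | nil => simp at hu
  | cons x u ih =>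
    have := wordMat_entries u
    rw [wordMat_cons]
    cases x
    · simp only [elemMat_false_mul]; omega
    · simp only [elemMat_true_mul]; exact ih (by simpa using hu)

lemma wordMat_injective : Function.Injective wordMat := by
  intro u
  induction u with
  | nil =>
    intro v h
    cases v with
    | nil => rfl
    | cons y v =>
      have hv := wordMat_entries v
      rw [wordMat_cons, wordMat_nil] at h
      have e1 := congrArg (fun g : SL2Z => g 0 1) h
      have e2 := congrArg (fun g : SL2Z => g 1 0) h
      cases y
      · simp only [elemMat_false_mul] at e1 e2; simp at e1 e2; omega
      · simp only [elemMat_true_mul] at e1 e2; simp at e1 e2; omega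
  | cons x u ih =>
    intro v h
    have hu := wordMat_entries u
    cases v with
    | nil =>
      rw [wordMat_cons, wordMat_nil] at h
      have e1 := congrArg (fun g : SL2Z => g 0 1) h
      have e2 := congrArg (fun g : SL2Z => g 1 0) h
      cases x
      · simp only [elemMat_false_mul] at e1 e2; simp at e1 e2; omega
      · simp only [elemMat_true_mul] at e1 e2; simp at e1 e2; omega
    | cons y v =>
      have hv := wordMat_entries v
      rw [wordMat_cons, wordMat_cons] at h
      by_cases hxy : x = y
      · subst hxy
        rw [ih (mul_left_cancel h)]
      · exfalso
        have e1 := congrArg (fun g : SL2Z => g 0 0) h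
        have e2 := congrArg (fun g : SL2Z => g 1 0) h
        cases x <;> cases y <;> simp only [elemMat_false_mul, elemMat_true_mul] at e1 e2 <;>
          first | exact hxy rfl | omega

lemma exists_wordMat_eq (n : ℕ) (g : SL2Z) (ha : 0 ≤ g 0 0) (hb : 0 ≤ g 0 1) (hc : 0 ≤ g 1 0)
    (hd : 0 ≤ g 1 1) (hn : g 0 0 + g 0 1 + g 1 0 + g 1 1 ≤ n) : ∃ u, wordMat u = g := by
  induction n generalizing g with
  | zero =>
    have := SL2Z.det_eq g
    have : g 0 0 = 0 := by omega
    have : g 0 1 = 0 := by omega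
    simp_all
  | succ n ih =>
    have hdet := SL2Z.det_eq g
    have had : 1 ≤ g 0 0 * g 1 1 := by nlinarith [mul_nonneg hb hc]
    have ha' : 1 ≤ g 0 0 := by
      by_contra! h
      have : g 0 0 = 0 := by omega
      simp [this] at had
    have hd' : 1 ≤ g 1 1 := by
      by_contra! h
      have : g 1 1 = 0 := by omega
      simp [this] at had
    by_cases h1 : g 1 0 ≤ g 0 0 ∧ g 1 1 ≤ g 0 1
    · have e0 := elemMat_true_mul ((elemMat true)⁻¹ * g) 0
      have e1 := elemMat_true_mul ((elemMat true)⁻¹ * g) 1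
      rw [mul_inv_cancel_left] at e0 e1
      obtain ⟨u, hu⟩ := ih ((elemMat true)⁻¹ * g) (by omega) (by omega) (by omega) (by omega)
        (by push_cast at hn; omega)
      exact ⟨true :: u, by rw [wordMat_cons, hu, mul_inv_cancel_left]⟩
    · by_cases h2 : g 0 0 ≤ g 1 0 ∧ g 0 1 ≤ g 1 1
      · have e0 := elemMat_false_mul ((elemMat false)⁻¹ * g) 0
        have e1 := elemMat_false_mul ((elemMat false)⁻¹ * g) 1
        rw [mul_inv_cancel_left] at e0 e1
        obtain ⟨u, hu⟩ := ih ((elemMat false)⁻¹ * g) (by omega) (by omega) (by omega) (by omega)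
          (by push_cast at hn; omega)
        exact ⟨false :: u, by rw [wordMat_cons, hu, mul_inv_cancel_left]⟩
      · refine ⟨[], ?_⟩
        rw [wordMat_nil]
        have hlt : g 1 0 < g 0 0 ∧ g 0 1 < g 1 1 := by
          by_contra hcon
          rcases le_or_gt (g 0 0) (g 1 0) with h | h
          · have h3 : g 1 1 < g 0 1 := by
              by_contra! h4
              exact h2 ⟨h, h4⟩
            nlinarith [mul_le_mul h h3.le hd (by omega)]
          · have h3 : g 1 1 ≤ g 0 1 := by
              by_contra! h4
              exact hcon ⟨h, h4⟩
            exact h1 ⟨h.le, h3⟩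
        have hb0 : g 0 1 = 0 := by nlinarith
        have hc0 : g 1 0 = 0 := by nlinarith
        have ha1 : g 0 0 = 1 := by nlinarith
        have hd1 : g 1 1 = 1 := by nlinarith
        apply SL2Z.ext_entries <;> simp [*]

lemma isRotated_of_append_eq_append {α : Type*} (n : ℕ) {u v w : List α} (hn : u.length ≤ n)
    (h : u ++ v = w ++ u) : v.IsRotated w := by
  induction n generalizing u with
  | zero =>
    have : u = [] := List.length_eq_zero_iff.mp (by omega)
    subst this
    simp at h
    rw [h]
  | succ n ih =>
    rcases List.append_eq_append_iff.mp h with ⟨t, ht, ht'⟩ | ⟨t, ht, ht'⟩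
    · rw [ht, ht']
      exact List.isRotated_append
    · by_cases hw : w = []
      · subst hw
        have := congrArg List.length h
        have hv : v = [] := by simpa using this
        rw [hv]
      · have hpos := List.length_pos_iff.mpr hw
        have hl := congrArg List.length ht
        rw [List.length_append] at hl
        exact ih (u := t) (by omega) (ht'.symm.trans ht)

lemma code_cons (k : ℕ) (l : List ℕ) :
    code (k :: l) = List.replicate k true ++ false :: code l := by
  simp [code]

lemma code_append (l l' : List ℕ) : code (l ++ l') = code l ++ code l' := by
  simp [code]

lemma code_injective : Function.Injective code := by
  intro l
  induction l with
  | nil =>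
    intro l' h
    cases l' with
    | nil => rfl
    | cons k l' => simp [code] at h
  | cons k l ih =>
    intro l' h
    cases l' with
    | nil => simp [code] at h
    | cons k' l' =>
      rw [code_cons, code_cons] at h
      have key : ∀ (k k' : ℕ) (s s' : List Bool), List.replicate k true ++ false :: s =
          List.replicate k' true ++ false :: s' → k = k' ∧ s = s' := by
        intro k
        induction k with
        | zero => intro k' s s' h; cases k' <;> simp_all [List.replicate_succ]
        | succ k ihk =>
          intro k' s s' h
          cases k' with
          | zero => simp [List.replicate_succ] at h
          | succ k' =>
            simp only [List.replicate_succ, List.cons_append, List.cons.injEq, true_and] at h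
            simpa using ihk k' s s' h
      obtain ⟨rfl, hs⟩ := key _ _ _ _ h
      rw [ih hs]

lemma exists_code_append_replicate (u : List Bool) :
    ∃ l k, u = code l ++ List.replicate k true := by
  induction u with
  | nil => exact ⟨[], 0, rfl⟩
  | cons x u ih =>
    obtain ⟨l, k, rfl⟩ := ih
    cases x
    · exact ⟨0 :: l, k, by simp [code_cons]⟩
    · cases l with
      | nil => exact ⟨[], k + 1, by simp [code, List.replicate_succ]⟩
      | cons m l => exact ⟨(m + 1) :: l, k, by simp [code_cons, List.replicate_succ]⟩

lemma code_ne_append_true (l : List ℕ) (u : List Bool) : code l ≠ u ++ [true] := by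
  intro h
  rcases List.eq_nil_or_concat l with rfl | ⟨l', k, rfl⟩
  · simp [code] at h
  · have := congrArg List.getLast? h
    simp [code] at this

lemma exists_code_eq_of_append_eq_code {u v : List Bool} {l : List ℕ} (h : v ++ u = code l) :
    ∃ l', u = code l' := by
  obtain ⟨l', k, rfl⟩ := exists_code_append_replicate u
  cases k with
  | zero => exact ⟨l', by simp⟩
  | succ k =>
    rw [List.replicate_succ', ← List.append_assoc, ← List.append_assoc] at h
    exact absurd h.symm (code_ne_append_true _ _)

lemma isRotated_of_code_isRotated {l l' : List ℕ} (h : (code l).IsRotated (code l')) :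
    l.IsRotated l' := by
  obtain ⟨n, hn, h⟩ := List.isRotated_iff_mod.mp h
  rw [List.rotate_eq_drop_append_take hn] at h
  obtain ⟨s, hs⟩ := exists_code_eq_of_append_eq_code h
  obtain ⟨t, ht⟩ := exists_code_eq_of_append_eq_code (List.take_append_drop n (code l))
  have hl : l = s ++ t := code_injective (by
    rw [code_append, ← hs, ← ht, List.take_append_drop])
  have hl' : l' = t ++ s := code_injective (by rw [code_append, ← hs, ← ht, h])
  rw [hl, hl']
  exact List.isRotated_append

/-- The conjugating matrix is, up to sign, nonnegative or the inverse of a nonnegative matrix, so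
the equation can be read in the free monoid of words. -/
lemma isRotated_of_semiconj {u v : List Bool} (hu : false ∈ u) (hv : false ∈ v) {g : SL2Z}
    (h : g * wordMat u = wordMat v * g) : u.IsRotated v := by
  have conj_of_nonneg : ∀ {u v : List Bool} {g : SL2Z}, g * wordMat u = wordMat v * g →
      0 ≤ g 0 0 → 0 ≤ g 0 1 → 0 ≤ g 1 0 → 0 ≤ g 1 1 → u.IsRotated v := by
    intro u v g h ha hb hc hd
    obtain ⟨w, rfl⟩ := exists_wordMat_eq (g 0 0 + g 0 1 + g 1 0 + g 1 1).toNat g ha hb hc hd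
      (by omega)
    rw [← wordMat_append, ← wordMat_append] at h
    exact isRotated_of_append_eq_append _ le_rfl (wordMat_injective h)
  have inv_entries : ∀ x : SL2Z, x⁻¹ 0 0 = x 1 1 ∧ x⁻¹ 0 1 = -x 0 1 ∧ x⁻¹ 1 0 = -x 1 0 ∧
      x⁻¹ 1 1 = x 0 0 := by
    intro x
    simp [Matrix.SpecialLinearGroup.coe_inv, Matrix.adjugate_fin_two]
  have neg_entries : ∀ (x : SL2Z) (i j : Fin 2), (-x) i j = -x i j := by
    intro x i j
    simp
  have hinv : g⁻¹ * wordMat v = wordMat u * g⁻¹ := by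
    rw [eq_mul_inv_iff_mul_eq, mul_assoc, ← h, inv_mul_cancel_left]
  have hneg : -g * wordMat u = wordMat v * -g := by rw [neg_mul, mul_neg, h]
  have hneg_inv : -g⁻¹ * wordMat v = wordMat u * -g⁻¹ := by rw [neg_mul, mul_neg, hinv]
  have hdet := SL2Z.det_eq g
  have htr : wordMat u 0 0 + wordMat u 1 1 = wordMat v 0 0 + wordMat v 1 1 := by
    have e : wordMat v = g * wordMat u * g⁻¹ := by rw [h, mul_inv_cancel_right]
    have e0 := congrArg (fun x : SL2Z => x 0 0) e
    have e1 := congrArg (fun x : SL2Z => x 1 1) e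
    simp only [SL2Z.mul_apply, inv_entries] at e0 e1
    rw [e0, e1]
    linear_combination (-wordMat u 0 0 - wordMat u 1 1) * hdet
  have e0 := congrArg (fun x : SL2Z => x 0 0) h
  have e1 := congrArg (fun x : SL2Z => x 1 1) h
  simp only [SL2Z.mul_apply] at e0 e1
  have hru := wordMat_lower_left_pos hu
  have hrv := wordMat_lower_left_pos hv
  obtain ⟨-, hqu, -, -⟩ := wordMat_entries u
  obtain ⟨-, hqv, -, -⟩ := wordMat_entries v
  have ha : g 0 0 * (wordMat v 0 0 - wordMat u 0 0) =
      g 0 1 * wordMat u 1 0 - wordMat v 0 1 * g 1 0 := by linarith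
  have hd : g 1 1 * (wordMat v 0 0 - wordMat u 0 0) =
      wordMat v 1 0 * g 0 1 - g 1 0 * wordMat u 0 1 := by
    linear_combination e1 - g 1 1 * htr
  have hbc : 0 ≤ g 0 1 * g 1 0 := by
    by_contra! hbc
    have had : 0 < (g 0 0 * (wordMat v 0 0 - wordMat u 0 0)) *
        (g 1 1 * (wordMat v 0 0 - wordMat u 0 0)) := by
      rw [ha, hd]
      rcases mul_neg_iff.mp hbc with ⟨hb, hc⟩ | ⟨hb, hc⟩
      · apply mul_pos <;> nlinarith [mul_pos hb hru, mul_pos hb hrv]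
      · apply mul_pos_of_neg_of_neg <;> nlinarith [mul_pos_of_neg_of_neg hb (neg_neg_of_pos hru)]
    have : 0 < g 0 0 * g 1 1 := by
      by_contra! hle
      nlinarith [mul_nonneg (neg_nonneg.mpr hle) (sq_nonneg (wordMat v 0 0 - wordMat u 0 0))]
    omega
  have had : 0 < g 0 0 * g 1 1 := by linarith
  rcases mul_pos_iff.mp had with ⟨ha, hd⟩ | ⟨ha, hd⟩ <;>
    rcases mul_nonneg_iff.mp hbc with ⟨hb, hc⟩ | ⟨hb, hc⟩
  · exact conj_of_nonneg h ha.le hb hc hd.le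
  · refine (conj_of_nonneg hinv ?_ ?_ ?_ ?_).symm <;> simp only [inv_entries] <;> omega
  · refine (conj_of_nonneg hneg_inv ?_ ?_ ?_ ?_).symm <;>
      simp only [neg_entries, inv_entries] <;> omega
  · refine conj_of_nonneg hneg ?_ ?_ ?_ ?_ <;> simp only [neg_entries] <;> omega

lemma SL2Z.mk_eq_mk_iff {g h : SL2Z} : (g : PSL2Z) = (h : PSL2Z) ↔ h = g ∨ h = -g := by
  rw [QuotientGroup.eq, Matrix.SpecialLinearGroup.mem_center_iff]
  constructor
  · rintro ⟨r, hr, h'⟩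
    have hr : r = 1 ∨ r = -1 := by simpa using hr
    rcases hr with rfl | rfl
    · left
      have : g⁻¹ * h = 1 := Subtype.ext (by rw [← h']; simp)
      exact (inv_mul_eq_one.mp this).symm
    · right
      have : g⁻¹ * h = -1 := Subtype.ext (by rw [← h']; simp)
      rw [inv_mul_eq_iff_eq_mul.mp this, mul_neg, mul_one]
  · rintro (rfl | rfl)
    · exact ⟨1, by simp, by simp⟩
    · exact ⟨-1, by simp, by simp⟩

lemma Xb_mul_Yb : Xb * Yb = (elemMat true : PSL2Z) := by
  refine congrArg QuotientGroup.mk (SL2Z.ext_entries ?_ ?_ ?_ ?_ : Xm * Ym = elemMat true) <;>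
    simp only [SL2Z.mul_apply] <;> simp [Xm, Ym, elemMat]

lemma Xb_mul_elemMat_true : Xb * (elemMat true : PSL2Z) = (elemMat false : PSL2Z) := by
  refine SL2Z.mk_eq_mk_iff.mpr (Or.inr (SL2Z.ext_entries ?_ ?_ ?_ ?_ :
    elemMat false = -(Xm * elemMat true))) <;>
    simp only [Matrix.SpecialLinearGroup.coe_neg, Matrix.neg_apply, SL2Z.mul_apply] <;>
    simp [Xm, elemMat]

lemma prod_mul_elemMat_true (l : List ℕ) (hl : ∀ m ∈ l, 2 ≤ m) :
    (l.map fun m => (Xb * Yb) ^ (m - 1) * Xb).prod * (elemMat true : PSL2Z) =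
      (elemMat true : PSL2Z) * (wordMat (code (l.map (· - 2))) : PSL2Z) := by
  induction l with
  | nil => simp [code, wordMat_nil]
  | cons m l ih =>
    have hm : 2 ≤ m := hl m (by simp)
    obtain ⟨k, rfl⟩ := Nat.exists_eq_add_of_le' hm
    have hrep : wordMat (List.replicate k true) = elemMat true ^ k := by simp [wordMat]
    rw [List.map_cons, List.prod_cons, mul_assoc, ih fun m hm => hl m (by simp [hm]),
      List.map_cons, Nat.add_sub_cancel, code_cons, wordMat_append, wordMat_cons, hrep, Xb_mul_Yb]
    simp only [QuotientGroup.mk_mul, QuotientGroup.mk_pow,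
      ← Xb_mul_elemMat_true]
    rw [show k + 2 - 1 = k + 1 by omega, pow_succ']
    simp only [mul_assoc]

lemma isConj_wordMat_W (l : List ℕ) (hl : ∀ m ∈ l, 2 ≤ m) :
    IsConj (wordMat (code (l.reverse.map (· - 2))) : PSL2Z) (W l) := by
  rw [isConj_iff]
  refine ⟨(elemMat true : PSL2Z), ?_⟩
  rw [mul_inv_eq_iff_eq_mul, W, prod_mul_elemMat_true]
  simpa using hl

lemma isRotated_of_isConj_wordMat {u v : List Bool} (hu : false ∈ u) (hv : false ∈ v)
    (h : IsConj (wordMat u : PSL2Z) (wordMat v : PSL2Z)) : u.IsRotated v := by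
  obtain ⟨c, hc⟩ := isConj_iff.mp h
  obtain ⟨g, rfl⟩ := QuotientGroup.mk_surjective c
  rcases SL2Z.mk_eq_mk_iff.mp
    (show ((g * wordMat u * g⁻¹ : SL2Z) : PSL2Z) = (wordMat v : PSL2Z) from hc) with h | h
  · exact isRotated_of_semiconj hu hv (g := g) (by rw [h, inv_mul_cancel_right])
  · have e0 := congrArg (fun x : SL2Z => (x : Matrix (Fin 2) (Fin 2) ℤ).trace) h
    simp only [Matrix.SpecialLinearGroup.coe_neg, Matrix.trace_neg,
      Matrix.SpecialLinearGroup.coe_mul] at e0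
    rw [Matrix.trace_mul_comm, ← mul_assoc, ← Matrix.SpecialLinearGroup.coe_mul,
      inv_mul_cancel, Matrix.SpecialLinearGroup.coe_one, one_mul, Matrix.trace_fin_two,
      Matrix.trace_fin_two] at e0
    have := wordMat_entries u
    have := wordMat_entries v
    omega

lemma isConj_W_of_isRotated {l l' : List ℕ} (h : l.IsRotated l') : IsConj (W l) (W l') := by
  obtain ⟨n, hn, rfl⟩ := List.isRotated_iff_mod.mp h
  rw [List.rotate_eq_drop_append_take hn]
  conv_lhs => rw [← List.take_append_drop n l]
  simp only [W, List.reverse_append, List.map_append, List.prod_append]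
  exact isConj_iff.mpr ⟨_, (by rw [← mul_assoc, mul_inv_cancel_right])⟩

theorem stmt_19 (l₁ l₂ : List ℕ) (h₁ : l₁ ≠ []) (h₂ : l₂ ≠ [])
    (hm₁ : ∀ m ∈ l₁, 2 ≤ m) (hm₂ : ∀ m ∈ l₂, 2 ≤ m) :
    IsConj (W l₁) (W l₂) ↔ l₁.IsRotated l₂ := by
  refine ⟨fun h => ?_, isConj_W_of_isRotated⟩
  have mem_code : ∀ l : List ℕ, l ≠ [] → false ∈ code (l.reverse.map (· - 2)) := by
    intro l hl
    obtain ⟨m, hm⟩ := List.exists_mem_of_ne_nil l hl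
    simpa [code] using ⟨m, hm⟩
  have hrot := isRotated_of_code_isRotated <| isRotated_of_isConj_wordMat (mem_code l₁ h₁)
    (mem_code l₂ h₂) <| ((isConj_wordMat_W l₁ hm₁).trans h).trans (isConj_wordMat_W l₂ hm₂).symm
  have add_sub : ∀ l : List ℕ, (∀ m ∈ l, 2 ≤ m) →
      (l.reverse.map (· - 2)).map (· + 2) = l.reverse := by
    intro l hl
    rw [List.map_map]
    refine (List.map_congr_left fun m hm => ?_).trans (List.map_id _)
    exact Nat.sub_add_cancel (hl m (List.mem_reverse.mp hm))
  have := hrot.map (· + 2)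
  rw [add_sub l₁ hm₁, add_sub l₂ hm₂] at this
  simpa using this.reverse
end
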